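/- For every positive integer N, the error term R̃ defined implicitly by the expansion p(n) = (e^{r_n} (−log t_n)^{3/2} / (√2 · π · √(1 + 2c_n²))) · (1 − Σ_{ℓ=1}^{N} D_ℓ/(1 + 2c_n²)^ℓ + R̃(n)) satisfies n^{N/2} · R̃(n) → 0 as n → ∞. -/

import Mathlib

open Real Filter

/-- `κ₁(t) = ∑_{j≥1} j·t^j/(1−t^j)`. -/
noncomputable def kappa1 (t : ℝ) : ℝ :=
  ∑' j : ℕ, ((j : ℝ) + 1) * t ^ (j + 1) / (1 - t ^ (j + 1))

/-- `κ₂(t) = ∑_{j≥1} j²·t^j/(1−t^j)²`. -/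
noncomputable def kappa2 (t : ℝ) : ℝ :=
  ∑' j : ℕ, ((j : ℝ) + 1) ^ 2 * t ^ (j + 1) / (1 - t ^ (j + 1)) ^ 2

/-- `r_n = √((2π²/3)(n − 1/24) + 1/4)`. -/
noncomputable def rseq (n : ℕ) : ℝ :=
  Real.sqrt (2 * Real.pi ^ 2 / 3 * ((n : ℝ) - 1 / 24) + 1 / 4)

/-- `D_ℓ = (−1)^{ℓ+1}·((ℓ+1)/4^ℓ)·∑_{k=0}^{ℓ+1} (−1)^k·2^k·C(2ℓ,k)/(ℓ+1−k)!`. -/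
noncomputable def Dcoef (l : ℕ) : ℝ :=
  (-1) ^ (l + 1) * (((l : ℝ) + 1) / 4 ^ l) *
    ∑ k ∈ Finset.range (l + 2),
      (-1) ^ k * 2 ^ k * (Nat.choose (2 * l) k : ℝ) / (Nat.factorial (l + 1 - k) : ℝ)

/-- `c_n² = κ₂(t_n)·(log t_n)²` written as a function of `t_n`. -/
noncomputable def csq (t : ℝ) : ℝ := kappa2 t * (Real.log t) ^ 2

namespace PX
open scoped PowerSeries.WithPiTopology Topology

noncomputable def pp (n : ℕ) : ℝ := (Fintype.card (Nat.Partition n) : ℝ)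

noncomputable def gser (i : ℕ) : PowerSeries ℝ :=
  PowerSeries.mk fun n => if (i + 1) ∣ n then 1 else 0

lemma gser_eq (i : ℕ) : (∑' j : ℕ, (PowerSeries.X : PowerSeries ℝ) ^ ((i + 1) * j)) = gser i := by
  apply HasSum.tsum_eq
  rw [HasSum, PowerSeries.WithPiTopology.tendsto_iff_coeff_tendsto]
  intro d
  apply tendsto_atTop_of_eventually_const (i₀ := Finset.range (d + 1))
  intro s hs
  rw [map_sum]
  simp only [PowerSeries.coeff_X_pow, gser, PowerSeries.coeff_mk]
  split_ifs with h
  · obtain ⟨k, rfl⟩ := h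
    rw [Finset.sum_eq_single k]
    · simp
    · intro b _ hb
      rw [if_neg]
      intro h
      exact hb (Nat.eq_of_mul_eq_mul_left (Nat.succ_pos i) h).symm
    · intro hk
      exfalso
      apply hk
      apply hs
      simp only [Finset.mem_range]
      nlinarith
  · apply Finset.sum_eq_zero
    intro b _
    rw [if_neg]
    rintro rfl
    exact h (Dvd.intro _ rfl)

noncomputable def pm (m n : ℕ) : ℝ := PowerSeries.coeff n (∏ i ∈ Finset.range m, gser i)

lemma pm_tendsto (n : ℕ) : Tendsto (fun m => pm m n) atTop (𝓝 (pp n)) := by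
  have h := Nat.Partition.hasProd_powerSeriesMk_card_restricted ℝ (fun _ => True)
  simp only [if_true, gser_eq] at h
  have h2 := h.tendsto_prod_nat
  rw [PowerSeries.WithPiTopology.tendsto_iff_coeff_tendsto] at h2
  have h3 := h2 n
  simp only [PowerSeries.coeff_mk] at h3
  have e : pp n = ((Nat.Partition.restricted n fun x => True).card : ℝ) := by
    simp [pp, Nat.Partition.restricted, Finset.card_univ]
  rw [e]
  exact h3

lemma pm_succ (m n : ℕ) : pm (m + 1) n =
    ∑ p ∈ Finset.HasAntidiagonal.antidiagonal n, pm m p.1 * (if (m + 1) ∣ p.2 then 1 else 0) := by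
  rw [pm, Finset.prod_range_succ, PowerSeries.coeff_mul]
  simp [pm, gser]

lemma pm_nonneg (m n : ℕ) : 0 ≤ pm m n := by
  induction m generalizing n with
  | zero => simp only [pm, Finset.range_zero, Finset.prod_empty, PowerSeries.coeff_one]; split_ifs <;> norm_num
  | succ m ih =>
    rw [pm_succ]
    apply Finset.sum_nonneg
    intro p _
    have := ih p.1
    split_ifs <;> simp [this]

lemma pm_mono (n : ℕ) : Monotone (fun m => pm m n) := by
  apply monotone_nat_of_le_succ
  intro m
  rw [pm_succ]
  have : pm m n = pm m ((n, 0) : ℕ × ℕ).1 * (if (m + 1) ∣ ((n, 0) : ℕ × ℕ).2 then 1 else 0) := by simp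
  rw [this]
  apply Finset.single_le_sum (f := fun p : ℕ × ℕ => pm m p.1 * (if (m + 1) ∣ p.2 then (1:ℝ) else 0))
  · intro p _
    have := pm_nonneg m p.1
    split_ifs <;> simp [this]
  · simp

lemma pm_le (m n : ℕ) : pm m n ≤ pp n :=
  (pm_mono n).ge_of_tendsto (pm_tendsto n) m

lemma hasSum_gser (i : ℕ) {q : ℂ} (hq : ‖q‖ < 1) :
    Summable (fun n : ℕ => ‖((if (i + 1) ∣ n then (1:ℝ) else 0 : ℝ) : ℂ) * q ^ n‖) ∧
    HasSum (fun n : ℕ => ((if (i + 1) ∣ n then (1:ℝ) else 0 : ℝ) : ℂ) * q ^ n)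
      (1 - q ^ (i + 1))⁻¹ := by
  constructor
  · apply Summable.of_nonneg_of_le (fun _ => norm_nonneg _) (f := fun n => ‖q‖ ^ n) _
      (summable_geometric_of_lt_one (norm_nonneg _) hq)
    intro n
    split_ifs <;> simp
  · have hq' : ‖q ^ (i + 1)‖ < 1 := by
      rw [norm_pow]; exact pow_lt_one₀ (norm_nonneg _) hq (by simp)
    have h := hasSum_geometric_of_norm_lt_one hq'
    have hinj : Function.Injective (fun j : ℕ => (i + 1) * j) :=
      fun a b hab => Nat.eq_of_mul_eq_mul_left (Nat.succ_pos i) hab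
    rw [← hinj.hasSum_iff]
    · have e : ((fun n : ℕ => ((if (i + 1) ∣ n then (1:ℝ) else 0 : ℝ) : ℂ) * q ^ n) ∘
          fun j => (i + 1) * j) = fun j => (q ^ (i + 1)) ^ j := by
        funext j
        simp [pow_mul]
      rw [e]
      exact h
    · intro x hx
      have : ¬ (i + 1) ∣ x := by
        rintro ⟨k, rfl⟩
        exact hx ⟨k, rfl⟩
      simp [this]

lemma cauchy_aux (f g : ℕ → ℂ) (a b : ℂ) (h1 : Summable fun n => ‖f n‖) (h2 : HasSum f a)
    (g1 : Summable fun n => ‖g n‖) (g2 : HasSum g b) (F : ℕ → ℂ)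
    (hF : ∀ n, F n = ∑ p ∈ Finset.HasAntidiagonal.antidiagonal n, f p.1 * g p.2) :
    Summable (fun n => ‖F n‖) ∧ HasSum F (a * b) := by
  obtain rfl : F = _ := funext hF
  have e := tsum_mul_tsum_eq_tsum_sum_antidiagonal_of_summable_norm h1 g1
  have s := summable_norm_sum_mul_antidiagonal_of_summable_norm h1 g1
  refine ⟨s, ?_⟩
  rw [h2.tsum_eq, g2.tsum_eq] at e
  rw [e]
  exact s.of_norm.hasSum

lemma hasSum_pm (m : ℕ) {q : ℂ} (hq : ‖q‖ < 1) :
    Summable (fun n : ℕ => ‖(pm m n : ℂ) * q ^ n‖) ∧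
    HasSum (fun n : ℕ => (pm m n : ℂ) * q ^ n) (∏ i ∈ Finset.range m, (1 - q ^ (i + 1))⁻¹) := by
  induction m with
  | zero =>
    have : ∀ n, n ≠ 0 → (pm 0 n : ℂ) * q ^ n = 0 := by
      intro n hn
      simp [pm, PowerSeries.coeff_one, hn]
    constructor
    · apply summable_of_ne_finset_zero (s := {0})
      intro n hn
      rw [this n (by simpa using hn), norm_zero]
    · convert hasSum_single 0 this
      simp [pm]
  | succ m ih =>
    obtain ⟨h1, h2⟩ := ih
    obtain ⟨g1, g2⟩ := hasSum_gser m hq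
    have key : ∀ n, (pm (m + 1) n : ℂ) * q ^ n = ∑ p ∈ Finset.HasAntidiagonal.antidiagonal n,
        ((pm m p.1 : ℂ) * q ^ p.1) * (((if (m + 1) ∣ p.2 then (1:ℝ) else 0 : ℝ) : ℂ) * q ^ p.2) := by
      intro n
      rw [pm_succ]
      push_cast
      rw [Finset.sum_mul]
      apply Finset.sum_congr rfl
      intro p hp
      rw [Finset.HasAntidiagonal.mem_antidiagonal] at hp
      rw [← hp, pow_add]
      ring
    rw [Finset.prod_range_succ]
    exact cauchy_aux _ _ _ _ h1 h2 g1 g2 _ key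

lemma prod_tendsto {q : ℂ} (hq : ‖q‖ < 1) :
    (∏' i : ℕ, (1 - q ^ (i + 1))) ≠ 0 ∧
    Tendsto (fun m => ∏ i ∈ Finset.range m, (1 - q ^ (i + 1))⁻¹) atTop
      (𝓝 (∏' i : ℕ, (1 - q ^ (i + 1)))⁻¹) := by
  have hne : (∏' i : ℕ, (1 - q ^ (i + 1))) ≠ 0 := by
    have := tprod_one_add_ne_zero_of_summable (f := fun n : ℕ ↦ -q ^ (n+1)) ?_ ?_
    · simpa [sub_eq_add_neg] using this
    · intro i h
      have : q ^ (i + 1) = 1 := by linear_combination -h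
      have h2 : ‖q ^ (i + 1)‖ < 1 := by
        rw [norm_pow]; exact pow_lt_one₀ (norm_nonneg _) hq (by simp)
      rw [this] at h2
      simp at h2
    · simpa using (summable_nat_add_iff 1).mpr (summable_geometric_of_lt_one (norm_nonneg _) hq)
  refine ⟨hne, ?_⟩
  have := (ModularForm.multipliable_one_sub_pow hq).hasProd.tendsto_prod_nat
  have := this.inv₀ hne
  simpa [Finset.prod_inv_distrib] using this

lemma pp_nonneg (n : ℕ) : 0 ≤ pp n := by simp [pp]

lemma summable_pp {r : ℝ} (h0 : 0 ≤ r) (h1 : r < 1) : Summable (fun n => pp n * r ^ n) := by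
  have hq : ‖(r : ℂ)‖ < 1 := by simpa [abs_of_nonneg h0] using h1
  obtain ⟨-, ht⟩ := prod_tendsto hq
  have ht2 := ht.norm
  obtain ⟨B, hB⟩ := ht2.bddAbove_range
  apply summable_of_sum_range_le (c := B)
  · intro n; exact mul_nonneg (pp_nonneg n) (pow_nonneg h0 n)
  · intro n
    have hl : Tendsto (fun m => ∑ i ∈ Finset.range n, pm m i * r ^ i) atTop
        (𝓝 (∑ i ∈ Finset.range n, pp i * r ^ i)) :=
      tendsto_finsetSum _ fun i _ => (pm_tendsto i).mul_const _
    apply le_of_tendsto' hl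
    intro m
    obtain ⟨s1, s2⟩ := hasSum_pm m hq
    have e : ∀ i, ‖(pm m i : ℂ) * (r:ℂ) ^ i‖ = pm m i * r ^ i := by
      intro i
      simp [abs_of_nonneg h0, abs_of_nonneg (pm_nonneg m i)]
    simp_rw [e] at s1
    have s3 : HasSum (fun i => pm m i * r ^ i) (∏ i ∈ Finset.range m, (1 - r ^ (i + 1))⁻¹) := by
      rw [← Complex.hasSum_ofReal]
      push_cast
      exact s2
    calc ∑ i ∈ Finset.range n, pm m i * r ^ i ≤ ∏ i ∈ Finset.range m, (1 - r ^ (i + 1))⁻¹ :=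
          sum_le_hasSum _ (fun i _ => mul_nonneg (pm_nonneg m i) (pow_nonneg h0 i)) s3
      _ ≤ ‖∏ i ∈ Finset.range m, (1 - (r:ℂ) ^ (i + 1))⁻¹‖ := by
          have : (∏ i ∈ Finset.range m, (1 - (r:ℂ) ^ (i + 1))⁻¹) =
            ((∏ i ∈ Finset.range m, (1 - r ^ (i + 1))⁻¹ : ℝ) : ℂ) := by push_cast; rfl
          rw [this, Complex.norm_real]
          exact le_abs_self _
      _ ≤ B := hB ⟨m, rfl⟩

noncomputable def PP (q : ℂ) : ℂ := ∑' n : ℕ, (pp n : ℂ) * q ^ n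

lemma summable_norm_pp {q : ℂ} (hq : ‖q‖ < 1) : Summable (fun n => ‖(pp n : ℂ) * q ^ n‖) := by
  have := summable_pp (norm_nonneg q) hq
  refine this.congr fun n => ?_
  simp [abs_of_nonneg (pp_nonneg n)]

lemma PP_tendsto {q : ℂ} (hq : ‖q‖ < 1) :
    Tendsto (fun m => ∏ i ∈ Finset.range m, (1 - q ^ (i + 1))⁻¹) atTop (𝓝 (PP q)) := by
  have h : ∀ m, ∏ i ∈ Finset.range m, (1 - q ^ (i + 1))⁻¹ = ∑' n : ℕ, (pm m n : ℂ) * q ^ n :=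
    fun m => ((hasSum_pm m hq).2.tsum_eq).symm
  simp_rw [h]
  apply tendsto_tsum_of_dominated_convergence (summable_norm_pp hq)
  · intro n
    apply Tendsto.mul_const
    exact (Complex.continuous_ofReal.tendsto _).comp (pm_tendsto n)
  · refine .of_forall fun m n => ?_
    simp only [norm_mul, Complex.norm_real, Real.norm_eq_abs, abs_of_nonneg (pp_nonneg n),
      abs_of_nonneg (pm_nonneg m n)]
    gcongr
    exact pm_le m n

lemma PP_eq {q : ℂ} (hq : ‖q‖ < 1) : PP q = (∏' i : ℕ, (1 - q ^ (i + 1)))⁻¹ :=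
  tendsto_nhds_unique (PP_tendsto hq) (prod_tendsto hq).2

end PX

namespace PX
open scoped Topology

lemma sqrt_I_mul {w : ℂ} (hw : 0 < w.re) :
    (Complex.I * w) ^ (2⁻¹ : ℂ) = Complex.I ^ (2⁻¹ : ℂ) * w ^ (2⁻¹ : ℂ) := by
  have hw0 : w ≠ 0 := by rintro rfl; simp at hw
  have harg := (Complex.abs_arg_lt_pi_div_two_iff (z := w)).2 (Or.inl hw)
  rw [abs_lt] at harg
  have h : Complex.log (Complex.I * w) = Complex.log Complex.I + Complex.log w := by
    apply Complex.log_mul Complex.I_ne_zero hw0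
    rw [Complex.arg_I]
    constructor <;> linarith [harg.1, harg.2, Real.pi_pos]
  rw [Complex.cpow_def_of_ne_zero (mul_ne_zero Complex.I_ne_zero hw0),
    Complex.cpow_def_of_ne_zero Complex.I_ne_zero, Complex.cpow_def_of_ne_zero hw0, h, add_mul,
    Complex.exp_add]

lemma eta_eq (ζ : ℂ) (hζ : 0 < ζ.re) :
    ModularForm.eta (Complex.I * (ζ / (2 * π))) = Complex.exp (-ζ / 24) * (PP (Complex.exp (-ζ)))⁻¹ := by
  have hn : ‖Complex.exp (-ζ)‖ < 1 := by
    rw [Complex.norm_exp]; simpa using hζ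
  rw [PP_eq hn, inv_inv, ModularForm.eta]
  have hpi : (π : ℂ) ≠ 0 := by exact_mod_cast Real.pi_ne_zero
  have e : 2 * (π:ℂ) * Complex.I * (Complex.I * (ζ / (2 * π))) = -ζ := by
    have : 2 * (π:ℂ) * Complex.I * (Complex.I * (ζ / (2 * π))) = (Complex.I * Complex.I) * ζ * (π / π) := by
      field_simp
    rw [this, Complex.I_mul_I, div_self hpi]; ring
  congr 1
  · rw [Function.Periodic.qParam, e]
    push_cast
    ring_nf
  · apply tprod_congr
    intro n
    rw [ModularForm.eta_q_eq_pow, e]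

lemma PP_transform (ζ : ℂ) (hζ : 0 < ζ.re) :
    PP (Complex.exp (-ζ)) = (ζ / (2 * π)) ^ (2⁻¹ : ℂ) *
      Complex.exp (π ^ 2 / (6 * ζ) - ζ / 24) * PP (Complex.exp (-(4 * π ^ 2 / ζ))) := by
  have hζ0 : ζ ≠ 0 := by rintro rfl; simp at hζ
  have hpi : (π : ℂ) ≠ 0 := by exact_mod_cast Real.pi_ne_zero
  have hw : 0 < (ζ / (2 * π)).re := by
    have : ζ / (2 * π) = ζ / ((2 * π : ℝ) : ℂ) := by push_cast; rfl
    rw [this, Complex.div_ofReal_re]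
    positivity
  have hz : (Complex.I * (ζ / (2 * π))) ∈ UpperHalfPlane.upperHalfPlaneSet := by
    simpa [UpperHalfPlane.upperHalfPlaneSet] using hw
  have h4 : 0 < (4 * π ^ 2 / ζ : ℂ).re := by
    have : (4 * π ^ 2 / ζ : ℂ) = ((4 * π ^ 2 : ℝ) : ℂ) * ζ⁻¹ := by push_cast; rw [div_eq_mul_inv]
    rw [this, Complex.re_ofReal_mul, Complex.inv_re]
    have := Complex.normSq_pos.2 hζ0
    positivity
  have h := ModularForm.eta_comp_eq_csqrt_I_inv hz
  simp only [Function.comp, Pi.smul_apply, Pi.mul_apply, smul_eq_mul, Complex.sqrt] at h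
  have e : -1 / (Complex.I * (ζ / (2 * π))) = Complex.I * ((4 * π ^ 2 / ζ) / (2 * π)) := by
    field_simp
    rw [Complex.I_sq]
    ring
  rw [e, eta_eq _ h4, eta_eq _ hζ, sqrt_I_mul hw] at h
  have hI : Complex.I ^ (2⁻¹ : ℂ) ≠ 0 := by
    rw [Complex.cpow_ne_zero_iff]
    simp
  have hP : ∀ ξ : ℂ, 0 < ξ.re → PP (Complex.exp (-ξ)) ≠ 0 := by
    intro ξ hξ
    have hn : ‖Complex.exp (-ξ)‖ < 1 := by
      rw [Complex.norm_exp]; simpa using hξ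
    rw [PP_eq hn]
    exact inv_ne_zero (prod_tendsto hn).1
  have p1 := hP _ hζ
  have p2 := hP _ h4
  rw [show (Complex.I ^ (2⁻¹ : ℂ))⁻¹ * (Complex.I ^ (2⁻¹ : ℂ) * (ζ / (2 * π)) ^ (2⁻¹ : ℂ) *
    (Complex.exp (-ζ / 24) * (PP (Complex.exp (-ζ)))⁻¹)) = (ζ / (2 * π)) ^ (2⁻¹ : ℂ) *
    (Complex.exp (-ζ / 24) * (PP (Complex.exp (-ζ)))⁻¹) by field_simp] at h
  have e2 : Complex.exp (π ^ 2 / (6 * ζ) - ζ / 24) * Complex.exp (-(4 * π ^ 2 / ζ) / 24) =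
      Complex.exp (-ζ / 24) := by
    rw [← Complex.exp_add]
    congr 1
    field_simp
    ring
  have ne1 : Complex.exp (-(4 * π ^ 2 / ζ) / 24) ≠ 0 := Complex.exp_ne_zero _
  have h' : Complex.exp (-(4 * ↑π ^ 2 / ζ) / 24) * PP (Complex.exp (-ζ)) =
      (ζ / (2 * ↑π)) ^ (2⁻¹:ℂ) * Complex.exp (-ζ / 24) * PP (Complex.exp (-(4 * ↑π ^ 2 / ζ))) := by
    clear e2 ne1
    generalize Complex.exp (-(4 * ↑π ^ 2 / ζ) / 24) = a1 at *
    generalize PP (Complex.exp (-ζ)) = a2 at *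
    generalize (ζ / (2 * ↑π)) ^ (2⁻¹:ℂ) = a3 at *
    generalize PP (Complex.exp (-(4 * ↑π ^ 2 / ζ))) = a4 at *
    generalize Complex.exp (-ζ / 24) = a5 at *
    field_simp at h
    linear_combination h
  rw [← e2] at h'
  apply mul_left_cancel₀ ne1
  rw [h']
  ring

lemma PP_sub_one : ∃ C : ℝ, 0 ≤ C ∧ ∀ q : ℂ, ‖q‖ ≤ 1 / 2 → ‖PP q - 1‖ ≤ C * ‖q‖ := by
  have hs := summable_pp (r := 1 / 2) (by norm_num) (by norm_num)
  have hs1 := (summable_nat_add_iff 1).2 hs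
  refine ⟨2 * ∑' n, pp (n + 1) * (1 / 2) ^ (n + 1), ?_, ?_⟩
  · have : 0 ≤ ∑' n, pp (n + 1) * (1 / 2) ^ (n + 1) := tsum_nonneg fun n => by
      have := pp_nonneg (n + 1)
      positivity
    positivity
  · intro q hq
    have hq1 : ‖q‖ < 1 := by linarith
    have s := (summable_norm_pp hq1)
    have : PP q - 1 = ∑' n, (pp (n + 1) : ℂ) * q ^ (n + 1) := by
      rw [PP, s.of_norm.tsum_eq_zero_add]
      simp [pp]
    rw [this]
    have s1 := (summable_nat_add_iff 1).2 s
    refine (norm_tsum_le_tsum_norm s1).trans ?_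
    rw [mul_assoc, mul_comm _ ‖q‖, ← mul_assoc, ← tsum_mul_left]
    apply s1.tsum_le_tsum _ (hs1.mul_left _)
    intro n
    rw [norm_mul, Complex.norm_real, Real.norm_eq_abs, abs_of_nonneg (pp_nonneg _), norm_pow,
      pow_succ, pow_succ]
    have : ‖q‖ ^ n ≤ (1 / 2) ^ n := pow_le_pow_left₀ (norm_nonneg _) hq n
    have hp := pp_nonneg (n + 1)
    calc pp (n + 1) * (‖q‖ ^ n * ‖q‖) ≤ pp (n + 1) * ((1 / 2) ^ n * ‖q‖) := by gcongr
      _ = _ := by ring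

end PX

namespace PX
open scoped Topology

lemma factor_bound {Q : ℂ} (hQ : ‖Q‖ < 1) :
    ‖(1 - Q)⁻¹‖ ≤ (1 - ‖Q‖)⁻¹ * Real.exp (Q.re - ‖Q‖) := by
  have h1 := Complex.hasSum_re (Complex.hasSum_taylorSeries_neg_log' hQ)
  have h2 := Real.hasSum_pow_div_log_of_abs_lt_one (x := ‖Q‖) (by simpa using hQ)
  have h3 := h2.sub h1
  have hnn : ∀ k : ℕ, 0 ≤ ‖Q‖ ^ (k + 1) / ((k : ℝ) + 1) - (Q ^ (k + 1) / ((k : ℂ) + 1)).re := by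
    intro k
    have : (Q ^ (k + 1) / ((k : ℂ) + 1)).re ≤ ‖Q ^ (k + 1) / ((k : ℂ) + 1)‖ := Complex.re_le_norm _
    have e : ‖Q ^ (k + 1) / ((k : ℂ) + 1)‖ = ‖Q‖ ^ (k + 1) / ((k : ℝ) + 1) := by
      rw [norm_div, norm_pow]
      congr 1
      rw [show ((k : ℂ) + 1) = (((k : ℝ) + 1 : ℝ) : ℂ) by push_cast; rfl, Complex.norm_real,
        Real.norm_eq_abs, abs_of_pos (by positivity)]
    linarith
  have h4 := le_hasSum h3 0 (fun k _ => hnn k)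
  simp only [Nat.cast_zero, zero_add, pow_one, div_one, Complex.neg_re, Complex.log_re] at h4
  have hne : 1 - Q ≠ 0 := by
    intro h
    rw [sub_eq_zero] at h
    rw [← h] at hQ; simp at hQ
  have hp : 0 < ‖1 - Q‖ := norm_pos_iff.2 hne
  have hp2 : 0 < 1 - ‖Q‖ := by linarith
  rw [norm_inv, ← Real.exp_log (inv_pos.2 hp), ← Real.exp_log (inv_pos.2 hp2), ← Real.exp_add,
    Real.exp_le_exp, Real.log_inv, Real.log_inv]
  linarith

lemma PP_minor {q : ℂ} (hq : ‖q‖ < 1) :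
    ‖PP q‖ ≤ ‖PP (‖q‖ : ℂ)‖ * Real.exp (‖q‖ / ‖1 - q‖ - ‖q‖ / (1 - ‖q‖)) := by
  have hr : ‖((‖q‖ : ℝ) : ℂ)‖ < 1 := by simpa using hq
  have key : ∀ m, ‖∏ i ∈ Finset.range m, (1 - q ^ (i + 1))⁻¹‖ ≤
      ‖∏ i ∈ Finset.range m, (1 - ((‖q‖ : ℝ) : ℂ) ^ (i + 1))⁻¹‖ *
      Real.exp (∑ i ∈ Finset.range m, ((q ^ (i + 1)).re - ‖q‖ ^ (i + 1))) := by
    intro m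
    rw [norm_prod, norm_prod, Real.exp_sum, ← Finset.prod_mul_distrib]
    apply Finset.prod_le_prod
    · intro i _; positivity
    · intro i _
      have hp : ‖q ^ (i + 1)‖ < 1 := by
        rw [norm_pow]; exact pow_lt_one₀ (norm_nonneg _) hq (by simp)
      have := factor_bound hp
      rw [norm_pow] at this
      have hlt : ‖q‖ ^ (i + 1) < 1 := by rwa [norm_pow] at hp
      rw [show (1 - ((‖q‖ : ℝ) : ℂ) ^ (i + 1))⁻¹ = (((1 - ‖q‖ ^ (i + 1))⁻¹ : ℝ) : ℂ) by push_cast; rfl,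
        Complex.norm_real, Real.norm_eq_abs, abs_of_pos (inv_pos.2 (by linarith))]
      exact this
  have l1 := (PP_tendsto hq).norm
  have l2 := (PP_tendsto hr).norm
  have hg1 : HasSum (fun i => (q ^ (i + 1)).re) (q / (1 - q)).re := by
    apply Complex.hasSum_re
    have := (hasSum_geometric_of_norm_lt_one hq).mul_left q
    simpa [pow_succ', div_eq_mul_inv] using this
  have hg2 : HasSum (fun i => ‖q‖ ^ (i + 1)) (‖q‖ / (1 - ‖q‖)) := by
    have := (hasSum_geometric_of_lt_one (norm_nonneg q) hq).mul_left ‖q‖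
    simpa [pow_succ', div_eq_mul_inv] using this
  have l3 := (hg1.sub hg2).tendsto_sum_nat
  have l4 := l2.mul ((Real.continuous_exp.tendsto _).comp l3)
  have := le_of_tendsto_of_tendsto' l1 l4 key
  refine this.trans ?_
  gcongr
  calc (q / (1 - q)).re ≤ ‖q / (1 - q)‖ := Complex.re_le_norm _
    _ = _ := norm_div _ _

lemma coeff_integral (c : ℝ) (hc : 0 < c) (n : ℕ) :
    ∫ θ in (-π)..π, PP (Complex.exp (-(c + θ * Complex.I))) * Complex.exp (n * (c + θ * Complex.I))
      = 2 * π * (pp n : ℂ) := by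
  have hq : ∀ θ : ℝ, ‖Complex.exp (-(c + θ * Complex.I))‖ = Real.exp (-c) := by
    intro θ; rw [Complex.norm_exp]; simp
  have hlt : Real.exp (-c) < 1 := by simpa using hc
  set f : ℕ → C(ℝ, ℂ) := fun m =>
    ⟨fun θ => (pp m : ℂ) * Complex.exp (-(c + θ * Complex.I)) ^ m * Complex.exp (n * (c + θ * Complex.I)),
      by fun_prop⟩ with hf
  have hnorm : ∀ m θ, ‖f m θ‖ = pp m * Real.exp (-c) ^ m * Real.exp (n * c) := by
    intro m θ
    simp only [hf, ContinuousMap.coe_mk, norm_mul, norm_pow, hq, Complex.norm_real, Real.norm_eq_abs,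
      abs_of_nonneg (pp_nonneg m)]
    congr 1
    rw [Complex.norm_exp]; simp
  have hs := summable_pp (Real.exp_pos (-c)).le hlt
  have H := intervalIntegral.hasSum_integral_of_dominated_convergence (μ := MeasureTheory.volume)
    (a := -π) (b := π)
    (F := fun m θ => f m θ)
    (f := fun θ : ℝ => PP (Complex.exp (-(c + θ * Complex.I))) * Complex.exp (n * (c + θ * Complex.I)))
    (fun m _ => pp m * Real.exp (-c) ^ m * Real.exp (n * c))
    (fun m => (f m).continuous.aestronglyMeasurable)
    (fun m => .of_forall fun θ _ => (hnorm m θ).le)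
    (.of_forall fun θ _ => hs.mul_right _)
    intervalIntegrable_const
    (.of_forall fun θ _ => by
      have : HasSum (fun m => (pp m : ℂ) * Complex.exp (-(c + θ * Complex.I)) ^ m)
          (PP (Complex.exp (-(c + θ * Complex.I)))) :=
        (summable_norm_pp (by rw [hq]; exact hlt)).of_norm.hasSum
      exact this.mul_right _)
  have hI : ∀ m, ∫ θ in (-π)..π, f m θ = if m = n then 2 * π * (pp n : ℂ) else 0 := by
    intro m
    have e : ∀ θ : ℝ, f m θ = ((pp m : ℂ) * Complex.exp ((n - m) * c)) *
        Complex.exp (((n - m) * Complex.I) * θ) := by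
      intro θ
      simp only [hf, ContinuousMap.coe_mk]
      rw [← Complex.exp_nat_mul, mul_assoc, mul_assoc, ← Complex.exp_add, ← Complex.exp_add]
      congr 2
      ring
    simp_rw [e]
    rw [intervalIntegral.integral_const_mul]
    split_ifs with h
    · subst h
      simp
      ring
    · have hne : ((n : ℂ) - m) * Complex.I ≠ 0 := by
        apply mul_ne_zero _ Complex.I_ne_zero
        rw [sub_ne_zero]
        intro hh
        exact h (by exact_mod_cast hh.symm)
      rw [integral_exp_mul_complex hne]
      have : Complex.exp (((n : ℂ) - m) * Complex.I * (π : ℝ)) =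
          Complex.exp (((n : ℂ) - m) * Complex.I * ((-π : ℝ) : ℂ)) := by
        rw [Complex.exp_eq_exp_iff_exists_int]
        refine ⟨(n : ℤ) - m, ?_⟩
        push_cast
        ring
      rw [this]
      simp
  simp_rw [hI] at H
  have H2 := hasSum_ite_eq n (2 * π * (pp n : ℂ))
  exact H.unique H2

end PX

namespace PX
open scoped Topology

/-- the model integrand -/
noncomputable def ff (ρ : ℝ) (w : ℂ) : ℂ := w ^ (2⁻¹ : ℂ) * Complex.exp ((ρ / 2) * (w + w⁻¹))

lemma ball_re {w : ℂ} (hw : w ∈ Metric.ball (2 : ℂ) 2) : 0 < w.re := by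
  rw [Metric.mem_ball, Complex.dist_eq] at hw
  have := (Complex.abs_re_le_norm (w - 2)).trans_lt hw
  rw [abs_lt] at this
  simp at this
  linarith [this.1]

lemma ff_diff (ρ : ℝ) : DifferentiableOn ℂ (ff ρ) (Metric.ball 2 2) := by
  intro w hw
  have h := ball_re hw
  have h0 : w ≠ 0 := by rintro rfl; simp at h
  have hs : w ∈ Complex.slitPlane := Or.inl h
  apply DifferentiableAt.differentiableWithinAt
  unfold ff
  apply DifferentiableAt.mul
  · exact DifferentiableAt.cpow_const differentiableAt_id hs
  · fun_prop (disch := assumption)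

lemma seg_mem {v : ℝ} (hv : v ^ 2 ≤ 3 / 4) : (1 / 2 : ℂ) + v * Complex.I ∈ Metric.ball (2 : ℂ) 2 := by
  rw [Metric.mem_ball, Complex.dist_eq, ← abs_of_nonneg (norm_nonneg _), ← abs_of_pos (two_pos (α := ℝ)), ← sq_lt_sq,
    ← Complex.normSq_eq_norm_sq, Complex.normSq_apply]
  simp
  norm_num
  nlinarith

lemma cos_ge_half {ψ : ℝ} (h : |ψ| ≤ π / 3) : 1 / 2 ≤ cos ψ := by
  rw [← Real.cos_abs, ← Real.cos_pi_div_three]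
  exact Real.cos_le_cos_of_nonneg_of_le_pi (abs_nonneg _) (by linarith [pi_pos]) h

lemma arc_mem {ψ : ℝ} (h : |ψ| ≤ π / 3) : Complex.exp (ψ * Complex.I) ∈ Metric.ball (2 : ℂ) 2 := by
  have hc := cos_ge_half h
  rw [Metric.mem_ball, Complex.dist_eq, ← abs_of_nonneg (norm_nonneg _), ← abs_of_pos (two_pos (α := ℝ)), ← sq_lt_sq,
    ← Complex.normSq_eq_norm_sq, Complex.normSq_apply]
  simp [Complex.exp_re, Complex.exp_im]
  nlinarith [Real.sin_sq_add_cos_sq ψ]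

lemma contour (ρ : ℝ) :
    ∫ v in (-(√3 / 2))..(√3 / 2), ff ρ (1 / 2 + v * Complex.I) =
    ∫ ψ in (-(π / 3))..(π / 3), ff ρ (Complex.exp (ψ * Complex.I)) * Complex.exp (ψ * Complex.I) := by
  obtain ⟨g, hg⟩ := (ff_diff ρ).isExactOn_ball
  have hcont : ContinuousOn (ff ρ) (Metric.ball 2 2) := (ff_diff ρ).continuousOn
  have h3 : (√3 / 2) ^ 2 = 3 / 4 := by rw [div_pow, Real.sq_sqrt (by norm_num)]; norm_num
  have hpos : 0 ≤ √3 / 2 := by positivity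
  have sv : ∀ v ∈ Set.uIcc (-(√3 / 2)) (√3 / 2), v ^ 2 ≤ 3 / 4 := by
    intro v hv
    rw [Set.uIcc_of_le (by linarith)] at hv
    rw [← h3]
    exact sq_le_sq' hv.1 hv.2
  have sp : ∀ v ∈ Set.uIcc (-(π / 3)) (π / 3), |v| ≤ π / 3 := by
    intro v hv
    rw [Set.uIcc_of_le (by linarith [pi_pos])] at hv
    exact abs_le.2 hv
  have d1 : ∀ v ∈ Set.uIcc (-(√3 / 2)) (√3 / 2),
      HasDerivAt (fun v : ℝ => g (1 / 2 + v * Complex.I) ) (ff ρ (1 / 2 + v * Complex.I) * Complex.I) v := by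
    intro v hv
    have h1 := hg _ (seg_mem (sv v hv))
    have h2 : HasDerivAt (fun v : ℝ => (1 / 2 : ℂ) + v * Complex.I) Complex.I v := by
      have := ((Complex.ofRealCLM.hasDerivAt (x := v)).mul_const Complex.I).const_add (1 / 2 : ℂ)
      simpa using this
    exact h1.comp v h2
  have d2 : ∀ ψ ∈ Set.uIcc (-(π / 3)) (π / 3),
      HasDerivAt (fun v : ℝ => g (Complex.exp (v * Complex.I)))
        (ff ρ (Complex.exp (ψ * Complex.I)) * (Complex.exp (ψ * Complex.I) * Complex.I)) ψ := by
    intro v hv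
    have h1 := hg _ (arc_mem (sp v hv))
    have h2 : HasDerivAt (fun v : ℝ => Complex.exp (v * Complex.I)) (Complex.exp (v * Complex.I) * Complex.I) v := by
      have := ((Complex.ofRealCLM.hasDerivAt (x := v)).mul_const Complex.I).cexp
      simpa using this
    exact h1.comp v h2
  have i1 : IntervalIntegrable (fun v : ℝ => ff ρ (1 / 2 + v * Complex.I) * Complex.I) MeasureTheory.volume
      (-(√3 / 2)) (√3 / 2) := by
    apply ContinuousOn.intervalIntegrable
    apply ContinuousOn.mul _ continuousOn_const
    exact hcont.comp (by fun_prop) (fun v hv => seg_mem (sv v hv))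
  have i2 : IntervalIntegrable (fun ψ : ℝ => ff ρ (Complex.exp (ψ * Complex.I)) * (Complex.exp (ψ * Complex.I) * Complex.I))
      MeasureTheory.volume (-(π / 3)) (π / 3) := by
    apply ContinuousOn.intervalIntegrable
    apply ContinuousOn.mul _ (by fun_prop)
    exact hcont.comp (by fun_prop) (fun v hv => arc_mem (sp v hv))
  have e1 := intervalIntegral.integral_eq_sub_of_hasDerivAt d1 i1
  have e2 := intervalIntegral.integral_eq_sub_of_hasDerivAt d2 i2
  have p1 : Complex.exp (((π / 3 : ℝ) : ℂ) * Complex.I) = 1 / 2 + ((√3 / 2 : ℝ) : ℂ) * Complex.I := by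
    rw [Complex.exp_mul_I, ← Complex.ofReal_cos, ← Complex.ofReal_sin, Real.cos_pi_div_three, Real.sin_pi_div_three]
    push_cast; ring
  have p2 : Complex.exp (((-(π / 3) : ℝ) : ℂ) * Complex.I) = 1 / 2 + ((-(√3 / 2) : ℝ) : ℂ) * Complex.I := by
    rw [Complex.exp_mul_I, ← Complex.ofReal_cos, ← Complex.ofReal_sin, Real.cos_neg, Real.sin_neg, Real.cos_pi_div_three, Real.sin_pi_div_three]
    push_cast; ring
  rw [p1, p2, ← e1] at e2
  simp_rw [← mul_assoc] at e2
  rw [intervalIntegral.integral_mul_const, intervalIntegral.integral_mul_const] at e2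
  exact (mul_right_cancel₀ Complex.I_ne_zero e2).symm

lemma arc_val (ρ : ℝ) {ψ : ℝ} (h : |ψ| ≤ π / 3) :
    ff ρ (Complex.exp (ψ * Complex.I)) * Complex.exp (ψ * Complex.I) =
      (Real.exp (ρ * cos ψ) : ℂ) * Complex.exp ((3 * ψ / 2 : ℝ) * Complex.I) := by
  have hh := abs_le.1 h
  unfold ff
  have hl : Complex.log (Complex.exp (ψ * Complex.I)) = ψ * Complex.I := by
    apply Complex.log_exp <;> simp <;> linarith [pi_pos]
  rw [Complex.cpow_def_of_ne_zero (Complex.exp_ne_zero _), hl, ← Complex.exp_neg, Complex.ofReal_exp,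
    mul_right_comm, ← Complex.exp_add, ← Complex.exp_add, ← Complex.exp_add]
  congr 1
  push_cast
  have := Complex.two_cos (ψ : ℂ)
  rw [show -(ψ * Complex.I) = -(ψ : ℂ) * Complex.I by ring, ← this]
  ring

lemma arc_real (ρ : ℝ) :
    ∫ ψ in (-(π / 3))..(π / 3), ff ρ (Complex.exp (ψ * Complex.I)) * Complex.exp (ψ * Complex.I)
    = ((∫ ψ in (-(π / 3))..(π / 3), Real.exp (ρ * cos ψ) * cos (3 * ψ / 2) : ℝ) : ℂ) := by
  have e : ∫ ψ in (-(π / 3))..(π / 3), ff ρ (Complex.exp (ψ * Complex.I)) * Complex.exp (ψ * Complex.I)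
      = ∫ ψ in (-(π / 3))..(π / 3), (Real.exp (ρ * cos ψ) : ℂ) * Complex.exp ((3 * ψ / 2 : ℝ) * Complex.I) := by
    apply intervalIntegral.integral_congr
    intro ψ hψ
    rw [Set.uIcc_of_le (by linarith [pi_pos])] at hψ
    exact arc_val ρ (abs_le.2 hψ)
  rw [e]
  set G : ℝ → ℂ := fun ψ => (Real.exp (ρ * cos ψ) : ℂ) * Complex.exp ((3 * ψ / 2 : ℝ) * Complex.I) with hG
  have hGc : Continuous G := by rw [hG]; fun_prop
  have s : ∫ ψ in (-(π / 3))..(π / 3), G (-ψ) = ∫ ψ in (-(π / 3))..(π / 3), G ψ := by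
    rw [intervalIntegral.integral_comp_neg]; simp
  have a : ∫ ψ in (-(π / 3))..(π / 3), (G ψ + G (-ψ)) =
      (∫ ψ in (-(π / 3))..(π / 3), G ψ) + ∫ ψ in (-(π / 3))..(π / 3), G (-ψ) :=
    intervalIntegral.integral_add (hGc.intervalIntegrable _ _) ((hGc.comp continuous_neg).intervalIntegrable _ _)
  have b : ∀ ψ, G ψ + G (-ψ) = 2 * ((Real.exp (ρ * cos ψ) * cos (3 * ψ / 2) : ℝ) : ℂ) := by
    intro ψ
    simp only [hG, Real.cos_neg]
    rw [← mul_add, Complex.ofReal_mul, Complex.ofReal_cos]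
    have := Complex.two_cos ((3 * ψ / 2 : ℝ) : ℂ)
    rw [mul_left_comm, this]
    congr 3
    push_cast; ring
  simp_rw [b] at a
  rw [s, intervalIntegral.integral_const_mul, intervalIntegral.integral_ofReal] at a
  have : (2 : ℂ) ≠ 0 := two_ne_zero
  apply mul_left_cancel₀ this
  rw [a]; ring

lemma arc_subst (ρ : ℝ) :
    ∫ ψ in (-(π / 3))..(π / 3), Real.exp (ρ * cos ψ) * cos (3 * ψ / 2) =
    Real.exp ρ * ∫ y in (-1)..1, Real.exp (-(ρ / 2) * y ^ 2) * (1 - y ^ 2) := by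
  have hd : ∀ ψ ∈ Set.uIcc (-(π / 3)) (π / 3), HasDerivAt (fun ψ => 2 * sin (ψ / 2)) (cos (ψ / 2)) ψ := by
    intro ψ _
    have := (((hasDerivAt_id ψ).div_const 2).sin).const_mul 2
    exact this.congr_deriv (by simp only [id]; ring)
  have := intervalIntegral.integral_comp_mul_deriv hd (by fun_prop)
    (g := fun y => Real.exp (-(ρ / 2) * y ^ 2) * (1 - y ^ 2)) (by fun_prop)
  have e1 : 2 * sin (π / 3 / 2) = 1 := by
    rw [show π / 3 / 2 = π / 6 by ring, Real.sin_pi_div_six]; norm_num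
  have e2 : 2 * sin (-(π / 3) / 2) = -1 := by
    rw [show -(π / 3) / 2 = -(π / 3 / 2) by ring, Real.sin_neg]; linarith
  rw [e1, e2] at this
  rw [← this, ← intervalIntegral.integral_const_mul]
  apply intervalIntegral.integral_congr
  intro ψ _
  simp only [Function.comp]
  rw [← mul_assoc, ← mul_assoc, ← Real.exp_add]
  have hc : cos ψ = 2 * cos (ψ / 2) ^ 2 - 1 := by rw [← Real.cos_two_mul]; congr 1; ring
  have hc3 : cos (3 * ψ / 2) = 4 * cos (ψ / 2) ^ 3 - 3 * cos (ψ / 2) := by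
    rw [← Real.cos_three_mul]; congr 1; ring
  have hs := Real.sin_sq_add_cos_sq (ψ / 2)
  have hs' : sin (ψ / 2) ^ 2 = 1 - cos (ψ / 2) ^ 2 := by linarith
  rw [hc3, hc, mul_assoc]
  have : ρ * (2 * cos (ψ / 2) ^ 2 - 1) = ρ + -(ρ / 2) * (2 * sin (ψ / 2)) ^ 2 := by
    rw [mul_pow, hs']; ring
  rw [this, mul_pow, hs']
  ring

lemma gauss_parts {ρ : ℝ} (hρ : 0 < ρ) :
    ∫ y in (-1)..1, Real.exp (-(ρ / 2) * y ^ 2) * (1 - y ^ 2) =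
    (1 - 1 / ρ) * (∫ y in (-1)..1, Real.exp (-(ρ / 2) * y ^ 2)) + 2 / ρ * Real.exp (-(ρ / 2)) := by
  have hd : ∀ y ∈ Set.uIcc (-1 : ℝ) 1, HasDerivAt (fun y => y * Real.exp (-(ρ / 2) * y ^ 2))
      (Real.exp (-(ρ / 2) * y ^ 2) * (1 - ρ * y ^ 2)) y := by
    intro y _
    have h1 := (((hasDerivAt_pow 2 y).const_mul (-(ρ / 2))).exp)
    have := (hasDerivAt_id y).mul h1
    exact this.congr_deriv (by simp only [id]; push_cast; ring)
  have hi := intervalIntegral.integral_eq_sub_of_hasDerivAt hd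
    (Continuous.intervalIntegrable (by fun_prop) _ _)
  have e : ∀ y : ℝ, Real.exp (-(ρ / 2) * y ^ 2) * (1 - y ^ 2) =
      (1 - 1 / ρ) * Real.exp (-(ρ / 2) * y ^ 2) + (1 / ρ) * (Real.exp (-(ρ / 2) * y ^ 2) * (1 - ρ * y ^ 2)) := by
    intro y; field_simp; ring
  simp_rw [e]
  rw [intervalIntegral.integral_add (Continuous.intervalIntegrable (by fun_prop) _ _)
    (Continuous.intervalIntegrable (by fun_prop) _ _), intervalIntegral.integral_const_mul,
    intervalIntegral.integral_const_mul, hi]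
  norm_num
  ring

lemma gauss_tail {ρ : ℝ} (hρ : 0 < ρ) :
    |(∫ y in (-1)..1, Real.exp (-(ρ / 2) * y ^ 2)) - √(2 * π / ρ)| ≤ 4 / ρ * Real.exp (-(ρ / 2)) := by
  have hb : 0 < ρ / 2 := by positivity
  have hint : MeasureTheory.Integrable (fun y : ℝ => Real.exp (-(ρ / 2) * y ^ 2)) := integrable_exp_neg_mul_sq hb
  have h0 := integral_gaussian_Ioi (ρ / 2)
  have h1 := intervalIntegral.integral_Ioi_sub_Ioi (a := (0:ℝ)) (b := 1) hint.integrableOn zero_le_one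
  have hneg : ∫ y in (-1)..0, Real.exp (-(ρ / 2) * y ^ 2) = ∫ y in (0:ℝ)..1, Real.exp (-(ρ / 2) * y ^ 2) := by
    have := intervalIntegral.integral_comp_neg (a := (0:ℝ)) (b := 1) (fun y => Real.exp (-(ρ / 2) * y ^ 2))
    simp only [neg_zero, even_two, Even.neg_pow] at this
    exact this.symm
  have hadd := intervalIntegral.integral_add_adjacent_intervals (a := (-1:ℝ)) (b := 0) (c := 1)
    (hint.intervalIntegrable) (hint.intervalIntegrable)
  have htail : ∫ y in Set.Ioi (1:ℝ), Real.exp (-(ρ / 2) * y ^ 2) ≤ 2 / ρ * Real.exp (-(ρ / 2)) := by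
    have := integral_exp_mul_Ioi (a := -(ρ / 2)) (by linarith) 1
    have e : - Real.exp (-(ρ / 2) * 1) / (-(ρ / 2)) = 2 / ρ * Real.exp (-(ρ / 2)) := by
      rw [mul_one]; field_simp
    rw [← e, ← this]
    apply MeasureTheory.setIntegral_mono_on hint.integrableOn (integrableOn_exp_mul_Ioi (by linarith) 1)
      measurableSet_Ioi
    intro y hy
    rw [Real.exp_le_exp]
    have hy : 1 < y := hy
    have : y ≤ y ^ 2 := by nlinarith
    nlinarith
  have hnn : 0 ≤ ∫ y in Set.Ioi (1:ℝ), Real.exp (-(ρ / 2) * y ^ 2) :=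
    MeasureTheory.setIntegral_nonneg measurableSet_Ioi (fun y _ => (Real.exp_pos _).le)
  have hs : π / (ρ / 2) = 2 * π / ρ := by field_simp
  rw [hs] at h0
  rw [← hadd, hneg, ← h1, h0, abs_le]
  have h4 : 4 / ρ * Real.exp (-(ρ / 2)) = 2 * (2 / ρ * Real.exp (-(ρ / 2))) := by ring
  constructor <;> rw [h4] <;> linarith

/-- main term -/
lemma main_integral {ρ : ℝ} (hρ : 1 ≤ ρ) :
    ‖(∫ v in (-(√3 / 2))..(√3 / 2), ff ρ (1 / 2 + v * Complex.I)) -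
      ((Real.exp ρ * (1 - 1 / ρ) * √(2 * π / ρ) : ℝ) : ℂ)‖ ≤ 6 * Real.exp (ρ / 2) := by
  have h0 : 0 < ρ := by linarith
  rw [contour, arc_real, ← Complex.ofReal_sub, Complex.norm_real, Real.norm_eq_abs, arc_subst, gauss_parts h0]
  have ht := gauss_tail h0
  set T := ∫ y in (-1)..1, Real.exp (-(ρ / 2) * y ^ 2)
  have hx : Real.exp (ρ / 2) = Real.exp ρ * Real.exp (-(ρ / 2)) := by rw [← Real.exp_add]; congr 1; ring
  have e : Real.exp ρ * ((1 - 1 / ρ) * T + 2 / ρ * Real.exp (-(ρ / 2))) - Real.exp ρ * (1 - 1 / ρ) * √(2 * π / ρ)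
    = Real.exp ρ * ((1 - 1 / ρ) * (T - √(2 * π / ρ)) + 2 / ρ * Real.exp (-(ρ / 2))) := by ring
  rw [e, abs_mul, abs_of_pos (Real.exp_pos ρ), hx, mul_left_comm]
  gcongr
  have hi : 1 / ρ ≤ 1 := by rw [div_le_one h0]; exact hρ
  have hi0 : 0 < 1 / ρ := by positivity
  refine (abs_add_le _ _).trans ?_
  rw [abs_mul, abs_of_nonneg (by linarith : 0 ≤ 1 - 1 / ρ), abs_of_nonneg (by positivity : 0 ≤ 2 / ρ * Real.exp (-(ρ / 2)))]
  have hE := Real.exp_pos (-(ρ / 2))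
  have h5 : |T - √(2 * π / ρ)| ≤ 4 * Real.exp (-(ρ / 2)) := by
    refine ht.trans ?_
    rw [show 4 / ρ = 4 * (1 / ρ) by ring]
    nlinarith
  have h6 : 2 / ρ * Real.exp (-(ρ / 2)) ≤ 2 * Real.exp (-(ρ / 2)) := by
    rw [show 2 / ρ = 2 * (1 / ρ) by ring]
    nlinarith
  nlinarith [abs_nonneg (T - √(2 * π / ρ))]

end PX

namespace PX
open scoped Topology

/-- the circle integrand -/
noncomputable def FF (n : ℕ) (c θ : ℝ) : ℂ :=
  PP (Complex.exp (-(c + θ * Complex.I))) * Complex.exp (n * (c + θ * Complex.I))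

lemma FF_cont (n : ℕ) {c : ℝ} (hc : 0 < c) : Continuous (FF n c) := by
  have hq : ∀ θ : ℝ, ‖Complex.exp (-(c + θ * Complex.I))‖ = Real.exp (-c) := by
    intro θ; rw [Complex.norm_exp]; simp
  have hlt : Real.exp (-c) < 1 := by simpa using hc
  unfold FF
  apply Continuous.mul _ (by fun_prop)
  unfold PP
  apply continuous_tsum (u := fun m => pp m * Real.exp (-c) ^ m)
  · intro m; fun_prop
  · exact summable_pp (Real.exp_pos _).le hlt
  · intro m θ
    rw [norm_mul, norm_pow, hq, Complex.norm_real, Real.norm_eq_abs, abs_of_nonneg (pp_nonneg m)]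

lemma pi_sq_lt : π ^ 2 < 9.9225 := by nlinarith [Real.pi_lt_d2, Real.pi_gt_three]

lemma major_pointwise : ∃ C : ℝ, 0 ≤ C ∧ ∀ (n : ℕ) (z : ℝ), 0 < z → z ≤ 1 →
    (n : ℝ) = π ^ 2 / 6 / z ^ 2 + 1 / 24 → ∀ v : ℝ, v ^ 2 ≤ 3 / 4 →
    ‖FF n (z / 2) (z * v) - (√(z / (2 * π)) : ℂ) * ff (π ^ 2 / 3 / z) (1 / 2 + v * Complex.I)‖
      ≤ C * Real.exp (π ^ 2 / 12 / z) := by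
  obtain ⟨C, hC, hP⟩ := PP_sub_one
  refine ⟨C, hC, ?_⟩
  intro n z hz hz1 hn v hv
  set w : ℂ := 1 / 2 + v * Complex.I with hw
  have hwre : w.re = 1 / 2 := by simp [hw]
  have hwim : w.im = v := by simp [hw]
  have hw0 : w ≠ 0 := by intro h; rw [h] at hwre; simp at hwre
  have hzc : (z : ℂ) ≠ 0 := by exact_mod_cast hz.ne'
  have hpi : (π : ℂ) ≠ 0 := by exact_mod_cast pi_ne_zero
  have hns : Complex.normSq w = 1 / 4 + v ^ 2 := by rw [Complex.normSq_apply, hwre, hwim]; ring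
  have hinv : (w⁻¹).re = (1 / 2) / (1 / 4 + v ^ 2) := by rw [Complex.inv_re, hns, hwre]
  have hinv_ge : 1 / 2 ≤ (w⁻¹).re := by
    rw [hinv, le_div_iff₀ (by positivity)]; linarith
  have hnw : ‖w‖ ≤ 1 := by
    rw [← abs_of_nonneg (norm_nonneg w), ← sq_le_one_iff_abs_le_one, ← Complex.normSq_eq_norm_sq, hns]
    linarith
  have hζ : ((z / 2 : ℝ) : ℂ) + ((z * v : ℝ) : ℂ) * Complex.I = z * w := by
    rw [hw]; push_cast; ring
  have hnc : (n : ℂ) = (π : ℂ) ^ 2 / 6 / z ^ 2 + 1 / 24 := by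
    have := congrArg (fun x : ℝ => (x : ℂ)) hn
    push_cast at this
    exact this
  have hre : 0 < ((z : ℂ) * w).re := by
    rw [Complex.re_ofReal_mul, hwre]; positivity
  unfold FF
  rw [hζ, PP_transform _ hre]
  have hsq : ((z : ℂ) * w / (2 * π)) ^ (2⁻¹ : ℂ) = (√(z / (2 * π)) : ℂ) * w ^ (2⁻¹ : ℂ) := by
    rw [show (z : ℂ) * w / (2 * π) = ((z / (2 * π) : ℝ) : ℂ) * w by push_cast; ring]
    have hzp : 0 < z / (2 * π) := by positivity
    have hne : ((z / (2 * π) : ℝ) : ℂ) ≠ 0 := by exact_mod_cast hzp.ne'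
    rw [Real.sqrt_eq_rpow, Complex.ofReal_cpow hzp.le, Complex.cpow_def_of_ne_zero (mul_ne_zero hne hw0),
      Complex.cpow_def_of_ne_zero hne, Complex.cpow_def_of_ne_zero hw0, Complex.log_ofReal_mul hzp hw0,
      ← Complex.exp_add, Complex.ofReal_log hzp.le]
    congr 1
    push_cast
    ring
  have hexp : Complex.exp ((π : ℂ) ^ 2 / (6 * (z * w)) - z * w / 24) * Complex.exp (n * (z * w)) =
      Complex.exp (((π ^ 2 / 3 / z : ℝ) / 2) * (w + w⁻¹)) := by
    rw [← Complex.exp_add, hnc]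
    congr 1
    push_cast
    field_simp
    ring
  set Q := Complex.exp (-(4 * (π : ℂ) ^ 2 / (z * w))) with hQ
  have e : ((z : ℂ) * w / (2 * π)) ^ (2⁻¹ : ℂ) * Complex.exp ((π : ℂ) ^ 2 / (6 * (z * w)) - z * w / 24) * PP Q *
      Complex.exp (n * (z * w)) - (√(z / (2 * π)) : ℂ) * ff (π ^ 2 / 3 / z) w =
      (√(z / (2 * π)) : ℂ) * (w ^ (2⁻¹ : ℂ)) * Complex.exp (((π ^ 2 / 3 / z : ℝ) / 2) * (w + w⁻¹)) * (PP Q - 1) := by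
    rw [hsq, ← hexp, ff, ← hexp]; ring
  rw [e]
  have hQn : ‖Q‖ = Real.exp (-(4 * π ^ 2 / z) * (w⁻¹).re) := by
    rw [hQ, Complex.norm_exp]
    congr 1
    rw [show -(4 * (π : ℂ) ^ 2 / (z * w)) = ((-(4 * π ^ 2 / z) : ℝ) : ℂ) * w⁻¹ by push_cast; field_simp,
      Complex.re_ofReal_mul]
  have hA : 0 < π ^ 2 / z := by positivity
  have hA1 : 9 ≤ π ^ 2 / z := by
    rw [le_div_iff₀ hz]; nlinarith [Real.pi_gt_three]
  have hQh : ‖Q‖ ≤ 1 / 2 := by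
    rw [hQn]
    calc Real.exp (-(4 * π ^ 2 / z) * (w⁻¹).re) ≤ Real.exp (-1) := by
          rw [Real.exp_le_exp]
          rw [show 4 * π ^ 2 / z = 4 * (π ^ 2 / z) by ring]
          nlinarith
      _ ≤ 1 / 2 := by
          rw [Real.exp_neg, inv_le_comm₀ (Real.exp_pos _) (by norm_num)]
          norm_num
          linarith [Real.add_one_le_exp (1:ℝ)]
  have h1 := hP Q hQh
  have n1 : ‖(√(z / (2 * π)) : ℂ)‖ ≤ 1 := by
    rw [Complex.norm_real, Real.norm_eq_abs, abs_of_nonneg (Real.sqrt_nonneg _), ← Real.sqrt_one]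
    apply Real.sqrt_le_sqrt
    rw [div_le_one (by positivity)]
    linarith [Real.pi_gt_three]
  have n2 : ‖w ^ (2⁻¹ : ℂ)‖ ≤ 1 := by
    have : (2⁻¹ : ℂ) = ((2⁻¹ : ℝ) : ℂ) := by push_cast; rfl
    rw [this, Complex.norm_cpow_real]
    exact Real.rpow_le_one (norm_nonneg _) hnw (by norm_num)
  have n3 : ‖Complex.exp (((π ^ 2 / 3 / z : ℝ) / 2) * (w + w⁻¹))‖ = Real.exp (π ^ 2 / 6 / z * (1 / 2 + (w⁻¹).re)) := by
    rw [Complex.norm_exp]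
    congr 1
    rw [show ((π ^ 2 / 3 / z : ℝ) : ℂ) / 2 = ((π ^ 2 / 6 / z : ℝ) : ℂ) by push_cast; ring,
      Complex.re_ofReal_mul, Complex.add_re, hwre]
  rw [norm_mul, norm_mul, norm_mul, n3]
  have n4 : ‖(√(z / (2 * π)) : ℂ)‖ * ‖w ^ (2⁻¹ : ℂ)‖ ≤ 1 := by
    calc _ ≤ (1:ℝ) * 1 := by gcongr
      _ = 1 := by norm_num
  calc _ ≤ 1 * Real.exp (π ^ 2 / 6 / z * (1 / 2 + (w⁻¹).re)) * (C * ‖Q‖) := by gcongr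
    _ = C * Real.exp (π ^ 2 / 6 / z * (1 / 2 + (w⁻¹).re) + -(4 * π ^ 2 / z) * (w⁻¹).re) := by
        rw [hQn, Real.exp_add]; ring
    _ ≤ _ := by
        gcongr
        rw [show π ^ 2 / 6 / z = (π ^ 2 / z) / 6 by ring, show 4 * π ^ 2 / z = 4 * (π ^ 2 / z) by ring,
          show π ^ 2 / 12 / z = (π ^ 2 / z) / 12 by ring]
        nlinarith

lemma PP_real_bound : ∃ C : ℝ, 0 ≤ C ∧ ∀ c : ℝ, 0 < c → c ≤ 1 →
    ‖PP ((Real.exp (-c) : ℝ) : ℂ)‖ ≤ C * Real.exp (π ^ 2 / 6 / c) := by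
  obtain ⟨C, hC, hP⟩ := PP_sub_one
  refine ⟨1 + C, by positivity, ?_⟩
  intro c hc hc1
  have hcc : (c : ℂ) ≠ 0 := by exact_mod_cast hc.ne'
  have h := PP_transform (c : ℂ) (by simpa using hc)
  rw [show Complex.exp (-(c : ℂ)) = ((Real.exp (-c) : ℝ) : ℂ) by push_cast; rfl] at h
  rw [h]
  set Q := Complex.exp (-(4 * (π : ℂ) ^ 2 / c)) with hQ
  have hA1 : 9 ≤ π ^ 2 / c := by
    rw [le_div_iff₀ hc]; nlinarith [Real.pi_gt_three]
  have hQn : ‖Q‖ = Real.exp (-(4 * (π ^ 2 / c))) := by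
    rw [hQ, show -(4 * (π : ℂ) ^ 2 / c) = ((-(4 * (π ^ 2 / c)) : ℝ) : ℂ) by push_cast; ring, Complex.norm_exp_ofReal]
  have hQh : ‖Q‖ ≤ 1 / 2 := by
    rw [hQn]
    calc _ ≤ Real.exp (-1) := by
          rw [Real.exp_le_exp]; linarith
      _ ≤ 1 / 2 := by
          rw [Real.exp_neg, inv_le_comm₀ (Real.exp_pos _) (by norm_num)]
          norm_num
          linarith [Real.add_one_le_exp (1:ℝ)]
  have h1 := hP Q hQh
  have h2 : ‖PP Q‖ ≤ 1 + C := by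
    calc ‖PP Q‖ = ‖1 + (PP Q - 1)‖ := by congr 1; ring
      _ ≤ ‖(1:ℂ)‖ + ‖PP Q - 1‖ := norm_add_le _ _
      _ ≤ 1 + C := by
        rw [norm_one]
        nlinarith
  have n2 : ‖((c : ℂ) / (2 * π)) ^ (2⁻¹ : ℂ)‖ ≤ 1 := by
    rw [show (2⁻¹ : ℂ) = ((2⁻¹ : ℝ) : ℂ) by push_cast; rfl, Complex.norm_cpow_real,
      show (c : ℂ) / (2 * π) = ((c / (2 * π) : ℝ) : ℂ) by push_cast; rfl, Complex.norm_real, Real.norm_eq_abs,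
      abs_of_nonneg (by positivity)]
    apply Real.rpow_le_one (by positivity) _ (by norm_num)
    rw [div_le_one (by positivity)]; linarith [Real.pi_gt_three]
  have n3 : ‖Complex.exp ((π : ℂ) ^ 2 / (6 * c) - c / 24)‖ ≤ Real.exp (π ^ 2 / 6 / c) := by
    rw [show (π : ℂ) ^ 2 / (6 * c) - c / 24 = ((π ^ 2 / 6 / c - c / 24 : ℝ) : ℂ) by push_cast; field_simp,
      Complex.norm_exp_ofReal, Real.exp_le_exp]
    linarith
  rw [norm_mul, norm_mul]
  calc _ ≤ 1 * Real.exp (π ^ 2 / 6 / c) * (1 + C) := by gcongr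
    _ = _ := by ring

lemma minor_geom {z θ : ℝ} (hz : 0 < z) (hz1 : z ≤ 1) (h1 : z * (√3 / 2) ≤ |θ|) (h2 : |θ| ≤ π) :
    let q : ℂ := Complex.exp (-((z / 2 : ℝ) + θ * Complex.I))
    ‖q‖ / ‖1 - q‖ - ‖q‖ / (1 - ‖q‖) ≤ 1 - 0.9 / z := by
  intro q
  set r := Real.exp (-(z / 2)) with hr
  have hq : ‖q‖ = r := by
    simp only [q]; rw [Complex.norm_exp]; simp [hr]
  have hr0 : 0 < r := Real.exp_pos _
  have hr1 : r < 1 := by rw [hr, Real.exp_lt_one_iff]; linarith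
  -- real part
  have hinv : r * Real.exp (z / 2) = 1 := by rw [hr, ← Real.exp_add]; simp
  have hE1 : 1 + z / 2 ≤ Real.exp (z / 2) := by linarith [Real.add_one_le_exp (z / 2)]
  have hE2 : Real.exp (z / 2) ≤ 1 + z / 2 + (z / 2) ^ 2 := by
    have := Real.abs_exp_sub_one_sub_id_le (x := z / 2) (by rw [abs_of_pos (by positivity)]; linarith)
    rw [abs_le] at this
    linarith [this.2]
  set X := Real.exp (z / 2) with hX
  have hX1 : 0 < X - 1 := by linarith
  have a1 : r / (1 - r) = 1 / (X - 1) := by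
    rw [div_eq_div_iff (by linarith) hX1.ne']
    nlinarith
  have a2 : 2 / z - 1 ≤ 1 / (X - 1) := by
    rw [le_div_iff₀ hX1]
    calc (2 / z - 1) * (X - 1) ≤ (2 / z - 1) * (z / 2 + (z / 2) ^ 2) := by
          have : 1 ≤ 2 / z := by rw [le_div_iff₀ hz]; linarith
          apply mul_le_mul_of_nonneg_left _ (by linarith)
          linarith
      _ = 1 - (z / 2) ^ 2 := by field_simp; ring
      _ ≤ 1 := by nlinarith [sq_nonneg (z / 2)]
  -- the norm of 1 - q
  have hqre : q.re = r * cos θ := by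
    simp only [q]; rw [Complex.exp_re]; simp [hr]
  have hqim : q.im = -(r * sin θ) := by
    simp only [q]; rw [Complex.exp_im]; simp [hr]
  have hns : ‖1 - q‖ ^ 2 = (1 - r) ^ 2 + 4 * r * sin (|θ| / 2) ^ 2 := by
    rw [← Complex.normSq_eq_norm_sq, Complex.normSq_apply, Complex.sub_re, Complex.sub_im, hqre, hqim]
    have hc : cos θ = 1 - 2 * sin (|θ| / 2) ^ 2 := by
      rw [← Real.cos_abs, show |θ| = 2 * (|θ| / 2) by ring, Real.cos_two_mul]
      have := Real.sin_sq_add_cos_sq (|θ| / 2)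
      rw [show 2 * (|θ| / 2) / 2 = |θ| / 2 by ring]
      linarith
    have hs : sin θ ^ 2 = 1 - cos θ ^ 2 := by linarith [Real.sin_sq_add_cos_sq θ]
    simp only [Complex.one_re, Complex.one_im]
    have : (1 - r * cos θ) * (1 - r * cos θ) + (0 - -(r * sin θ)) * (0 - -(r * sin θ)) =
      1 - 2 * r * cos θ + r ^ 2 * (cos θ ^ 2 + sin θ ^ 2) := by ring
    rw [this, hs, hc]; ring
  have h3 : √3 ^ 2 = 3 := Real.sq_sqrt (by norm_num)
  have h30 : 0 < √3 := by positivity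
  have h32 : √3 < 2 := by nlinarith
  set y := z * √3 / 4 with hy
  have hy0 : 0 < y := by positivity
  have hyz : y ^ 2 = 3 * z ^ 2 / 16 := by rw [hy, div_pow, mul_pow, h3]; ring
  have hzz : z ^ 2 ≤ 1 := by nlinarith
  have hy1 : y ≤ 1 := by nlinarith
  have hsin1 : sin y ≤ sin (|θ| / 2) := by
    apply Real.sin_le_sin_of_le_of_le_pi_div_two
    · linarith [pi_pos]
    · linarith
    · linarith
  have hsin2 : y - y ^ 3 / 4 < sin y := by
    have := Real.sin_gt_sub_cube hy0
    have h3 : 0 < y ^ 3 := by positivity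
    linarith
  have hsin3 : y ^ 2 * (1 - y ^ 2 / 2) ≤ sin (|θ| / 2) ^ 2 := by
    have hpos : 0 ≤ y - y ^ 3 / 4 := by
      have : y - y ^ 3 / 4 = y * (1 - y ^ 2 / 4) := by ring
      rw [this]; apply mul_nonneg hy0.le; nlinarith
    have h := pow_le_pow_left₀ hpos (hsin2.le.trans hsin1) 2
    refine le_trans ?_ h
    nlinarith [sq_nonneg (y ^ 3)]
  have hX2 : 1 - r = r * (X - 1) := by linarith
  have hns2 : r ^ 2 * (z ^ 2 / 1.21) ≤ ‖1 - q‖ ^ 2 := by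
    rw [hns, hX2]
    have b1 : z ^ 2 / 4 ≤ (X - 1) ^ 2 := by
      rw [show z ^ 2 / 4 = (z / 2) ^ 2 by ring]
      exact pow_le_pow_left₀ (by positivity) (by linarith) 2
    have b2 : 4 * r ^ 2 * sin (|θ| / 2) ^ 2 ≤ 4 * r * sin (|θ| / 2) ^ 2 := by
      have : r ^ 2 ≤ r := by rw [sq]; exact mul_le_of_le_one_left hr0.le hr1.le
      gcongr
    have b3 : z ^ 2 / 1.21 ≤ (X - 1) ^ 2 + 4 * sin (|θ| / 2) ^ 2 := by
      rw [hyz] at hsin3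
      have b5 : 3 * z ^ 2 / 16 * (1 - 3 / 32) ≤ sin (|θ| / 2) ^ 2 := by
        refine le_trans ?_ hsin3
        exact mul_le_mul_of_nonneg_left (by linarith) (by positivity)
      have b6 : z ^ 2 / 1.21 = z ^ 2 * (100 / 121) := by norm_num; ring
      rw [b6]
      linarith [sq_nonneg z]
    have b4 := mul_le_mul_of_nonneg_left b3 (sq_nonneg r)
    have b7 : (r * (X - 1)) ^ 2 = r ^ 2 * (X - 1) ^ 2 := by ring
    rw [b7]
    linarith
  have hns3 : r * (z / 1.1) ≤ ‖1 - q‖ := by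
    apply abs_le_of_sq_le_sq' _ (norm_nonneg _) |>.2
    rw [mul_pow, div_pow]
    norm_num at hns2 ⊢
    linarith
  have a3 : r / ‖1 - q‖ ≤ 1.1 / z := by
    rw [div_le_div_iff₀ (lt_of_lt_of_le (by positivity) hns3) hz]
    have : r * z = 1.1 * (r * (z / 1.1)) := by field_simp
    rw [this]
    gcongr
  rw [hq, a1]
  have : 1.1 / z - 2 / z = - (0.9 / z) := by ring
  linarith

lemma minor_pointwise : ∃ C : ℝ, 0 ≤ C ∧ ∀ (n : ℕ) (z : ℝ), 0 < z → z ≤ 1 →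
    (n : ℝ) = π ^ 2 / 6 / z ^ 2 + 1 / 24 → ∀ θ : ℝ, z * (√3 / 2) ≤ |θ| → |θ| ≤ π →
    ‖FF n (z / 2) θ‖ ≤ C * Real.exp (π ^ 2 / 3 / z - 0.07 / z) := by
  obtain ⟨C, hC, hP⟩ := PP_real_bound
  refine ⟨C * Real.exp 2, by positivity, ?_⟩
  intro n z hz hz1 hn θ h1 h2
  have hg := minor_geom hz hz1 h1 h2
  simp only at hg
  unfold FF
  set q : ℂ := Complex.exp (-(((z / 2 : ℝ) : ℂ) + θ * Complex.I)) with hqdef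
  have hq : ‖q‖ = Real.exp (-(z / 2)) := by
    rw [hqdef, Complex.norm_exp]; simp
  have hq1 : ‖q‖ < 1 := by rw [hq, Real.exp_lt_one_iff]; linarith
  have hm := PP_minor hq1
  have hb := hP (z / 2) (by positivity) (by linarith)
  rw [← hq] at hb
  have hn2 : ‖Complex.exp (n * (((z / 2 : ℝ) : ℂ) + θ * Complex.I))‖ = Real.exp (π ^ 2 / 12 / z + z / 48) := by
    rw [Complex.norm_exp]
    congr 1
    rw [show (n : ℂ) = ((n : ℝ) : ℂ) by push_cast; rfl, Complex.re_ofReal_mul, hn]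
    simp
    field_simp
    ring
  rw [norm_mul, hn2]
  calc _ ≤ (C * Real.exp (π ^ 2 / 6 / (z / 2)) * Real.exp (1 - 0.9 / z)) * Real.exp (π ^ 2 / 12 / z + z / 48) := by
        gcongr
        exact hm.trans (by gcongr)
    _ = C * Real.exp (π ^ 2 / 6 / (z / 2) + (1 - 0.9 / z) + (π ^ 2 / 12 / z + z / 48)) := by
        rw [Real.exp_add (π ^ 2 / 6 / (z / 2) + (1 - 0.9 / z)), Real.exp_add (π ^ 2 / 6 / (z / 2))]; ring
    _ ≤ C * Real.exp (2 + (π ^ 2 / 3 / z - 0.07 / z)) := by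
        apply mul_le_mul_of_nonneg_left _ hC
        rw [Real.exp_le_exp]
        have : π ^ 2 / 12 / z - 0.9 / z ≤ - 0.07 / z := by
          rw [← sub_div]
          gcongr
          linarith [pi_sq_lt]
        have e : π ^ 2 / 6 / (z / 2) = π ^ 2 / 3 / z := by field_simp; norm_num
        rw [e]
        have e2 : -0.07 / z = - (0.07 / z) := by ring
        linarith
    _ = _ := by rw [Real.exp_add]; ring

end PX

namespace PX
open scoped Topology

lemma pp_asymp : ∃ C : ℝ, 0 ≤ C ∧ ∀ (n : ℕ) (z : ℝ), 0 < z → z ≤ 1 →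
    (n : ℝ) = π ^ 2 / 6 / z ^ 2 + 1 / 24 →
    |2 * π * pp n - z * √(z / (2 * π)) * (Real.exp (π ^ 2 / 3 / z) * (1 - 1 / (π ^ 2 / 3 / z)) *
      √(2 * π / (π ^ 2 / 3 / z)))| ≤ C * Real.exp (π ^ 2 / 3 / z - 0.07 / z) := by
  obtain ⟨C1, hC1, hmaj⟩ := major_pointwise
  obtain ⟨C2, hC2, hmin⟩ := minor_pointwise
  refine ⟨C1 * 2 + 6 + 8 * C2, by positivity, ?_⟩
  intro n z hz hz1 hn
  set ρ := π ^ 2 / 3 / z with hρ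
  set E := Real.exp (ρ - 0.07 / z) with hE
  have hρ1 : 1 ≤ ρ := by
    rw [hρ, le_div_iff₀ hz]; nlinarith [Real.pi_gt_three]
  have hE1 : Real.exp (π ^ 2 / 12 / z) ≤ E := by
    rw [hE, Real.exp_le_exp, hρ, ← sub_div]; gcongr
    nlinarith [Real.pi_gt_three]
  have hE2 : Real.exp (ρ / 2) ≤ E := by
    rw [hE, Real.exp_le_exp]
    have : 0.07 / z ≤ ρ / 2 := by
      rw [hρ, show π ^ 2 / 3 / z / 2 = π ^ 2 / 6 / z by ring]; gcongr
      nlinarith [Real.pi_gt_three]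
    linarith
  have hE0 : 0 < E := Real.exp_pos _
  have h3 : √3 ^ 2 = 3 := Real.sq_sqrt (by norm_num)
  have h30 : 0 < √3 := by positivity
  have h32 : √3 < 2 := by nlinarith
  have hcont := FF_cont n (c := z / 2) (by positivity)
  have hint := fun a b => hcont.intervalIntegrable (μ := MeasureTheory.volume) a b
  set θ0 := z * (√3 / 2) with hθ0
  have hθ : 0 < θ0 := by positivity
  have hθ1 : θ0 < 1 := by nlinarith
  have hpi := Real.pi_gt_three
  have hpi4 := Real.pi_lt_four
  have key := coeff_integral (z / 2) (by positivity) n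
  change ∫ θ in (-π)..π, FF n (z / 2) θ = _ at key
  have s1 := intervalIntegral.integral_add_adjacent_intervals (hint (-π) (-θ0)) (hint (-θ0) θ0)
  have s2 := intervalIntegral.integral_add_adjacent_intervals (hint (-π) θ0) (hint θ0 π)
  rw [key] at s2
  have m1 : ‖∫ θ in (-π)..(-θ0), FF n (z / 2) θ‖ ≤ C2 * E * |(-θ0) - (-π)| := by
    apply intervalIntegral.norm_integral_le_of_norm_le_const
    intro θ hh
    rw [Set.uIoc_of_le (by linarith)] at hh
    have : θ < 0 := by linarith [hh.2]
    exact hmin n z hz hz1 hn θ (by rw [abs_of_neg this]; linarith [hh.2]) (by rw [abs_of_neg this]; linarith [hh.1])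
  have m2 : ‖∫ θ in θ0..π, FF n (z / 2) θ‖ ≤ C2 * E * |π - θ0| := by
    apply intervalIntegral.norm_integral_le_of_norm_le_const
    intro θ hh
    rw [Set.uIoc_of_le (by linarith)] at hh
    have : 0 < θ := by linarith [hh.1]
    exact hmin n z hz hz1 hn θ (by rw [abs_of_pos this]; linarith [hh.1]) (by rw [abs_of_pos this]; linarith [hh.2])
  have sub : ∫ θ in (-θ0)..θ0, FF n (z / 2) θ = z * ∫ v in (-(√3 / 2))..(√3 / 2), FF n (z / 2) (z * v) := by
    have := intervalIntegral.smul_integral_comp_mul_left (f := FF n (z / 2)) (a := -(√3 / 2)) (b := √3 / 2) z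
    rw [show z * -(√3 / 2) = -θ0 by rw [hθ0]; ring] at this
    rw [← hθ0, Complex.real_smul] at this
    exact this.symm
  have hvv : ∀ v ∈ Set.Icc (-(√3 / 2)) (√3 / 2), v ^ 2 ≤ 3 / 4 := by
    intro v hv
    have : (√3 / 2) ^ 2 = 3 / 4 := by rw [div_pow, h3]; norm_num
    rw [← this]
    exact sq_le_sq' hv.1 hv.2
  have hfi : IntervalIntegrable (fun v : ℝ => ff ρ (1 / 2 + v * Complex.I)) MeasureTheory.volume (-(√3 / 2)) (√3 / 2) := by
    apply ContinuousOn.intervalIntegrable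
    rw [Set.uIcc_of_le (by linarith)]
    exact (ff_diff ρ).continuousOn.comp (by fun_prop) (fun v hv => seg_mem (hvv v hv))
  have m3 : ‖∫ v in (-(√3 / 2))..(√3 / 2), (FF n (z / 2) (z * v) - (√(z / (2 * π)) : ℂ) * ff ρ (1 / 2 + v * Complex.I))‖
      ≤ C1 * E * |√3 / 2 - -(√3 / 2)| := by
    apply intervalIntegral.norm_integral_le_of_norm_le_const
    intro v hh
    rw [Set.uIoc_of_le (by linarith)] at hh
    refine (hmaj n z hz hz1 hn v (hvv v ⟨hh.1.le, hh.2⟩)).trans ?_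
    gcongr
  have hK : Continuous (fun v : ℝ => FF n (z / 2) (z * v)) := hcont.comp (by fun_prop)
  rw [intervalIntegral.integral_sub (hK.intervalIntegrable _ _)
    (hfi.const_mul _), intervalIntegral.integral_const_mul] at m3
  have m4 := main_integral hρ1
  set J := ∫ v in (-(√3 / 2))..(√3 / 2), ff ρ (1 / 2 + v * Complex.I)
  set K := ∫ v in (-(√3 / 2))..(√3 / 2), FF n (z / 2) (z * v)
  set A := ∫ θ in (-π)..(-θ0), FF n (z / 2) θ
  set B := ∫ θ in θ0..π, FF n (z / 2) θ
  set M := Real.exp ρ * (1 - 1 / ρ) * √(2 * π / ρ)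
  set S := √(z / (2 * π))
  have hS0 : 0 ≤ S := Real.sqrt_nonneg _
  have hS1 : S ≤ 1 := by
    rw [← Real.sqrt_one]
    apply Real.sqrt_le_sqrt
    rw [div_le_one (by positivity)]
    linarith
  rw [← s1, sub] at s2
  have e : ((2 * π * pp n - z * S * M : ℝ) : ℂ) = A + B + z * (K - S * J) + z * S * (J - M) := by
    push_cast
    rw [← s2]; ring
  rw [← Real.norm_eq_abs, ← Complex.norm_real, e]
  have b1 : |(-θ0) - (-π)| ≤ 4 := by rw [abs_le]; constructor <;> linarith
  have b2 : |π - θ0| ≤ 4 := by rw [abs_le]; constructor <;> linarith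
  have b3 : |√3 / 2 - -(√3 / 2)| ≤ 2 := by rw [abs_le]; constructor <;> linarith
  calc _ ≤ ‖A‖ + ‖B‖ + ‖(z : ℂ) * (K - S * J)‖ + ‖(z : ℂ) * S * (J - M)‖ := by
        refine (norm_add_le _ _).trans ?_
        gcongr
        refine (norm_add_le _ _).trans ?_
        gcongr
        exact norm_add_le _ _
    _ ≤ C2 * E * 4 + C2 * E * 4 + 1 * (C1 * E * 2) + 1 * 1 * (6 * E) := by
        gcongr
        · exact m1.trans (by gcongr)
        · exact m2.trans (by gcongr)
        · rw [norm_mul, Complex.norm_real, Real.norm_eq_abs, abs_of_pos hz]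
          gcongr
          exact m3.trans (by gcongr)
        · rw [norm_mul, norm_mul, Complex.norm_real, Real.norm_eq_abs, abs_of_pos hz, Complex.norm_real,
            Real.norm_eq_abs, abs_of_nonneg hS0]
          gcongr
          exact m4.trans (by gcongr)
    _ = _ := by ring

end PX

namespace PX
open scoped Topology

lemma G2_kappa {s : ℝ} (hs : 0 < s) (z : UpperHalfPlane) (hz : 2 * (π : ℂ) * Complex.I * (z : ℂ) = ((-s : ℝ) : ℂ)) :
    EisensteinSeries.G2 z = ((π ^ 2 / 3 - 8 * π ^ 2 * kappa1 (Real.exp (-s)) : ℝ) : ℂ) := by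
  have hlt : ‖Complex.exp ((-s : ℝ) : ℂ)‖ < 1 := by
    rw [Complex.norm_exp_ofReal, Real.exp_lt_one_iff]; linarith
  rw [EisensteinSeries.G2_eq_tsum_cexp, hz, riemannZeta_two, ← tsum_pow_div_one_sub_eq_tsum_sigma hlt 1,
    tsum_pnat_eq_tsum_succ (f := fun n : ℕ => (n : ℂ) ^ 1 * Complex.exp ((-s : ℝ) : ℂ) ^ n / (1 - Complex.exp ((-s : ℝ) : ℂ) ^ n))]
  unfold kappa1
  rw [Complex.ofReal_sub, Complex.ofReal_mul, Complex.ofReal_tsum]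
  congr 1
  · push_cast; ring
  · congr 1
    · push_cast; rfl
    · apply tsum_congr
      intro j
      push_cast
      simp

lemma kappa1_transform {s : ℝ} (hs : 0 < s) :
    kappa1 (Real.exp (-s)) = π ^ 2 / 6 / s ^ 2 + 1 / 24 - 1 / (2 * s) -
      4 * π ^ 2 / s ^ 2 * kappa1 (Real.exp (-(4 * π ^ 2 / s))) := by
  have hpi : (π : ℂ) ≠ 0 := by exact_mod_cast Real.pi_ne_zero
  have hsc : (s : ℂ) ≠ 0 := by exact_mod_cast hs.ne'
  let z : UpperHalfPlane := ⟨Complex.I * (s / (2 * π) : ℝ), by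
    rw [Complex.I_mul_im, Complex.ofReal_re]; positivity⟩
  have hz : (z : ℂ) = Complex.I * (s / (2 * π) : ℝ) := rfl
  have h1 := G2_kappa hs z (by
    rw [hz]; push_cast
    have : 2 * (π:ℂ) * Complex.I * (Complex.I * (s / (2 * π))) = (Complex.I * Complex.I) * s := by
      field_simp
    rw [this, Complex.I_mul_I]; ring)
  have h2 := G2_kappa (s := 4 * π ^ 2 / s) (by positivity) (ModularGroup.S • z) (by
    rw [UpperHalfPlane.modular_S_smul]
    simp only [hz]
    push_cast
    field_simp
    norm_num)
  have h3 := EisensteinSeries.G2_S_transform z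
  rw [h1, h2, hz] at h3
  have e1 : ((Complex.I * ((s / (2 * π) : ℝ) : ℂ)) ^ 2)⁻¹ = ((-(4 * π ^ 2 / s ^ 2) : ℝ) : ℂ) := by
    rw [mul_pow, Complex.I_sq]; push_cast; field_simp; ring
  have e2 : -2 * (π : ℂ) * Complex.I / (Complex.I * ((s / (2 * π) : ℝ) : ℂ)) = ((-(4 * π ^ 2 / s) : ℝ) : ℂ) := by
    push_cast; field_simp; ring
  rw [e1, e2] at h3
  have h4 : π ^ 2 / 3 - 8 * π ^ 2 * kappa1 (Real.exp (-s)) =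
      -(4 * π ^ 2 / s ^ 2) * (π ^ 2 / 3 - 8 * π ^ 2 * kappa1 (Real.exp (-(4 * π ^ 2 / s)))) - -(4 * π ^ 2 / s) := by
    exact_mod_cast h3
  have hp := pi_pos
  have h5 : kappa1 (Real.exp (-s)) = (π ^ 2 / 3 - (-(4 * π ^ 2 / s ^ 2) *
      (π ^ 2 / 3 - 8 * π ^ 2 * kappa1 (Real.exp (-(4 * π ^ 2 / s)))) - -(4 * π ^ 2 / s))) / (8 * π ^ 2) := by
    rw [← h4]; field_simp; ring
  rw [h5]
  field_simp
  ring

lemma term1_bound {q : ℝ} (h0 : 0 ≤ q) (h1 : q < 1) (j : ℕ) :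
    ((j : ℝ) + 1) * q ^ (j + 1) / (1 - q ^ (j + 1)) ≤ ((j : ℝ) + 1) * q ^ (j + 1) / (1 - q) := by
  have : q ^ (j + 1) ≤ q := pow_le_of_le_one h0 h1.le (by simp)
  have h2 : 0 < 1 - q := by linarith
  gcongr

lemma term2_bound {q : ℝ} (h0 : 0 ≤ q) (h1 : q < 1) (j : ℕ) :
    ((j : ℝ) + 1) ^ 2 * q ^ (j + 1) / (1 - q ^ (j + 1)) ^ 2 ≤ ((j : ℝ) + 1) ^ 2 * q ^ (j + 1) / (1 - q) ^ 2 := by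
  have : q ^ (j + 1) ≤ q := pow_le_of_le_one h0 h1.le (by simp)
  have h2 : 0 < 1 - q := by linarith
  gcongr

lemma sum_base (k : ℕ) {q : ℝ} (h0 : 0 ≤ q) (h1 : q < 1) :
    Summable fun j : ℕ => ((j : ℝ) + 1) ^ k * q ^ (j + 1) := by
  have := summable_pow_mul_geometric_of_norm_lt_one (R := ℝ) k (r := q) (by rw [Real.norm_eq_abs, abs_of_nonneg h0]; exact h1)
  have := (summable_nat_add_iff 1).2 this
  simpa using this

lemma term1_nonneg {q : ℝ} (h0 : 0 ≤ q) (h1 : q < 1) (j : ℕ) :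
    0 ≤ ((j : ℝ) + 1) * q ^ (j + 1) / (1 - q ^ (j + 1)) := by
  have : q ^ (j + 1) ≤ q := pow_le_of_le_one h0 h1.le (by simp)
  have h2 : 0 < 1 - q ^ (j + 1) := by linarith
  positivity

lemma term2_nonneg {q : ℝ} (h0 : 0 ≤ q) (j : ℕ) :
    0 ≤ ((j : ℝ) + 1) ^ 2 * q ^ (j + 1) / (1 - q ^ (j + 1)) ^ 2 := by
  positivity

lemma summable_k1 {q : ℝ} (h0 : 0 ≤ q) (h1 : q < 1) :
    Summable fun j : ℕ => ((j : ℝ) + 1) * q ^ (j + 1) / (1 - q ^ (j + 1)) := by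
  have := (sum_base 1 h0 h1).div_const (1 - q)
  simp only [pow_one] at this
  exact Summable.of_nonneg_of_le (term1_nonneg h0 h1) (term1_bound h0 h1) this

lemma summable_k2 {q : ℝ} (h0 : 0 ≤ q) (h1 : q < 1) :
    Summable fun j : ℕ => ((j : ℝ) + 1) ^ 2 * q ^ (j + 1) / (1 - q ^ (j + 1)) ^ 2 :=
  Summable.of_nonneg_of_le (term2_nonneg h0) (term2_bound h0 h1) ((sum_base 2 h0 h1).div_const _)

lemma kappa_small : ∃ C : ℝ, 0 ≤ C ∧ ∀ q : ℝ, 0 ≤ q → q ≤ 1 / 2 →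
    (0 ≤ kappa1 q ∧ kappa1 q ≤ C * q) ∧ (0 ≤ kappa2 q ∧ kappa2 q ≤ C * q) := by
  have hs1 : Summable fun j : ℕ => ((j : ℝ) + 1) ^ 1 * (1 / 2 : ℝ) ^ (j + 1) := sum_base 1 (by norm_num) (by norm_num)
  have hs2 : Summable fun j : ℕ => ((j : ℝ) + 1) ^ 2 * (1 / 2 : ℝ) ^ (j + 1) := sum_base 2 (by norm_num) (by norm_num)
  set S1 := ∑' j : ℕ, ((j : ℝ) + 1) ^ 1 * (1 / 2 : ℝ) ^ (j + 1)
  set S2 := ∑' j : ℕ, ((j : ℝ) + 1) ^ 2 * (1 / 2 : ℝ) ^ (j + 1)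
  have p1 : 0 ≤ S1 := tsum_nonneg fun j => by positivity
  have p2 : 0 ≤ S2 := tsum_nonneg fun j => by positivity
  have hpow : ∀ q : ℝ, 0 ≤ q → q ≤ 1 / 2 → ∀ j : ℕ, q ^ (j + 1) ≤ 2 * q * (1 / 2 : ℝ) ^ (j + 1) := by
    intro q h0 h1 j
    have : q ^ j ≤ (1 / 2) ^ j := pow_le_pow_left₀ h0 h1 j
    rw [pow_succ, pow_succ]
    nlinarith
  refine ⟨4 * S1 + 8 * S2, by positivity, fun q h0 h1 => ?_⟩
  have hq1 : q < 1 := by linarith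
  refine ⟨⟨tsum_nonneg (term1_nonneg h0 hq1), ?_⟩, ⟨tsum_nonneg (term2_nonneg h0), ?_⟩⟩
  · have : kappa1 q ≤ ∑' j : ℕ, (4 * q) * (((j : ℝ) + 1) ^ 1 * (1 / 2 : ℝ) ^ (j + 1)) := by
      apply Summable.tsum_le_tsum _ (summable_k1 h0 hq1) (hs1.mul_left _)
      intro j
      refine (term1_bound h0 hq1 j).trans ?_
      rw [div_le_iff₀ (by linarith)]
      calc ((j : ℝ) + 1) * q ^ (j + 1) ≤ ((j : ℝ) + 1) * (2 * q * (1 / 2 : ℝ) ^ (j + 1)) := by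
            gcongr; exact hpow q h0 h1 j
        _ = 4 * q * (((j : ℝ) + 1) ^ 1 * (1 / 2 : ℝ) ^ (j + 1)) * (1 / 2) := by ring
        _ ≤ _ := by gcongr; linarith
    rw [tsum_mul_left] at this
    change kappa1 q ≤ 4 * q * S1 at this
    nlinarith [mul_nonneg p2 h0]
  · have : kappa2 q ≤ ∑' j : ℕ, (8 * q) * (((j : ℝ) + 1) ^ 2 * (1 / 2 : ℝ) ^ (j + 1)) := by
      apply Summable.tsum_le_tsum _ (summable_k2 h0 hq1) (hs2.mul_left _)
      intro j
      refine (term2_bound h0 hq1 j).trans ?_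
      rw [div_le_iff₀ (by nlinarith)]
      calc ((j : ℝ) + 1) ^ 2 * q ^ (j + 1) ≤ ((j : ℝ) + 1) ^ 2 * (2 * q * (1 / 2 : ℝ) ^ (j + 1)) := by
            gcongr; exact hpow q h0 h1 j
        _ = 8 * q * (((j : ℝ) + 1) ^ 2 * (1 / 2 : ℝ) ^ (j + 1)) * (1 / 2) ^ 2 := by ring
        _ ≤ _ := by gcongr; linarith
    rw [tsum_mul_left] at this
    change kappa2 q ≤ 8 * q * S2 at this
    nlinarith [mul_nonneg p1 h0]

lemma kappa1_deriv {s : ℝ} (hs : 0 < s) :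
    HasDerivAt (fun s => kappa1 (Real.exp (-s))) (-kappa2 (Real.exp (-s))) s := by
  have hd : 0 < s / 2 := by positivity
  set q := Real.exp (-(s / 2)) with hq
  have hq0 : 0 < q := Real.exp_pos _
  have hq1 : q < 1 := by rw [hq, Real.exp_lt_one_iff]; linarith
  have := hasDerivAt_tsum_of_isPreconnected (𝕜 := ℝ) (F := ℝ) (t := Set.Ioi (s / 2)) (y₀ := s) (y := s)
    (u := fun j : ℕ => ((j : ℝ) + 1) ^ 2 * q ^ (j + 1) / (1 - q) ^ 2)
    (g := fun j s => ((j : ℝ) + 1) * Real.exp (-s) ^ (j + 1) / (1 - Real.exp (-s) ^ (j + 1)))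
    (g' := fun j s => -(((j : ℝ) + 1) ^ 2 * Real.exp (-s) ^ (j + 1) / (1 - Real.exp (-s) ^ (j + 1)) ^ 2))
    ((sum_base 2 hq0.le hq1).div_const _) isOpen_Ioi isPreconnected_Ioi ?_ ?_
    (by simp; linarith) (summable_k1 (Real.exp_pos _).le (by rw [Real.exp_lt_one_iff]; linarith)) (by simp; linarith)
  · rw [tsum_neg] at this
    exact this
  · intro j y hy
    have hy : s / 2 < y := hy
    have hlt : Real.exp (-y) ^ (j + 1) < 1 :=
      pow_lt_one₀ (Real.exp_pos _).le (by rw [Real.exp_lt_one_iff]; linarith) (by simp)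
    have h1 : HasDerivAt (fun y => Real.exp (-y) ^ (j + 1)) (-(((j : ℝ) + 1) * Real.exp (-y) ^ (j + 1))) y := by
      have := ((hasDerivAt_id y).neg.exp).pow (j + 1)
      exact this.congr_deriv (by simp [pow_succ]; ring)
    have h2 := (h1.const_mul ((j : ℝ) + 1)).div (h1.const_sub 1) (by linarith)
    refine h2.congr_deriv ?_
    have : 1 - Real.exp (-y) ^ (j + 1) ≠ 0 := by linarith
    rw [← neg_div]
    congr 1
    ring
  · intro j y hy
    have hy : s / 2 < y := hy
    rw [norm_neg, Real.norm_eq_abs, abs_of_nonneg (term2_nonneg (Real.exp_pos _).le j)]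
    refine (term2_bound (Real.exp_pos _).le (by rw [Real.exp_lt_one_iff]; linarith) j).trans ?_
    have hle : Real.exp (-y) ≤ q := by rw [hq, Real.exp_le_exp]; linarith
    have : 0 < 1 - q := by linarith
    gcongr

lemma kappa2_transform {s : ℝ} (hs : 0 < s) :
    kappa2 (Real.exp (-s)) = π ^ 2 / 3 / s ^ 3 - 1 / (2 * s ^ 2) -
      8 * π ^ 2 / s ^ 3 * kappa1 (Real.exp (-(4 * π ^ 2 / s)))
      + 16 * π ^ 4 / s ^ 4 * kappa2 (Real.exp (-(4 * π ^ 2 / s))) := by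
  have h1 := kappa1_deriv hs
  have hs' : 0 < 4 * π ^ 2 / s := by positivity
  have hi : HasDerivAt (fun s : ℝ => 4 * π ^ 2 / s) (-(4 * π ^ 2 / s ^ 2)) s := by
    have := (hasDerivAt_inv hs.ne').const_mul (4 * π ^ 2)
    exact this.congr_deriv (by field_simp)
  have h2 := (kappa1_deriv hs').comp s hi
  have hq : HasDerivAt (fun s : ℝ => 4 * π ^ 2 / s ^ 2) (-(8 * π ^ 2 / s ^ 3)) s := by
    have := ((hasDerivAt_pow 2 s).inv (by positivity)).const_mul (4 * π ^ 2)
    exact this.congr_deriv (by field_simp; norm_num; ring)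
  have hq2 : HasDerivAt (fun s : ℝ => π ^ 2 / 6 / s ^ 2 + 1 / 24 - 1 / (2 * s)) (-(π ^ 2 / 3 / s ^ 3) + 1 / (2 * s ^ 2)) s := by
    have a := ((hasDerivAt_pow 2 s).inv (by positivity)).const_mul (π ^ 2 / 6)
    have b := (hasDerivAt_inv hs.ne').const_mul (1 / 2 : ℝ)
    have c := (a.add_const (1 / 24)).sub b
    have e : (fun s : ℝ => π ^ 2 / 6 / s ^ 2 + 1 / 24 - 1 / (2 * s)) =
        (fun s : ℝ => (π ^ 2 / 6 * (s ^ 2)⁻¹ + 1 / 24) - 1 / 2 * s⁻¹) := by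
      funext x
      rw [one_div (2 * x), mul_inv]; ring
    rw [e]
    exact c.congr_deriv (by field_simp; ring)
  have h3 := hq2.sub (hq.mul h2)
  have he : (fun s => kappa1 (Real.exp (-s))) =ᶠ[𝓝 s] (fun s : ℝ => π ^ 2 / 6 / s ^ 2 + 1 / 24 - 1 / (2 * s)) -
      (fun s : ℝ => 4 * π ^ 2 / s ^ 2) * ((fun s => kappa1 (Real.exp (-s))) ∘ (fun s : ℝ => 4 * π ^ 2 / s)) := by
    filter_upwards [lt_mem_nhds hs] with x hx
    exact kappa1_transform hx
  have h4 := h3.congr_of_eventuallyEq he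
  have h5 := h1.unique h4
  simp only [Function.comp] at h5
  have h6 : kappa2 (Real.exp (-s)) = - (-kappa2 (Real.exp (-s))) := by ring
  rw [h6, h5]
  field_simp
  ring

end PX

namespace PX
open scoped Topology

lemma exp_small (m : ℕ) {s : ℝ} (hs : 0 < s) : exp (-(4 * π ^ 2 / s)) ≤ m.factorial * s ^ m := by
  have h1 : exp (-(4 * π ^ 2 / s)) ≤ exp (-(1 / s)) := by
    apply exp_le_exp.2
    apply neg_le_neg
    apply div_le_div_of_nonneg_right _ hs.le
    nlinarith [pi_gt_three]
  have h2 := Real.pow_div_factorial_le_exp (1 / s) (by positivity) m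
  have h3 : 0 < exp (1 / s) := exp_pos _
  refine h1.trans ?_
  rw [exp_neg]
  rw [inv_le_comm₀ h3 (by positivity)]
  refine le_trans (le_of_eq ?_) h2
  rw [one_div, inv_pow]
  field_simp

lemma kap_asymp (K : ℕ) : ∃ C, 0 ≤ C ∧ ∀ s : ℝ, 0 < s → s ≤ 1 →
    |kappa1 (exp (-s)) - (π ^ 2 / 6 / s ^ 2 + 1 / 24 - 1 / (2 * s))| ≤ C * s ^ K ∧
    |kappa2 (exp (-s)) * s ^ 2 - (π ^ 2 / 3 / s - 1 / 2)| ≤ C * s ^ K := by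
  obtain ⟨C0, hC0, hk⟩ := kappa_small
  set M : ℝ := C0 * (K + 2).factorial with hM
  have hM0 : 0 ≤ M := by positivity
  refine ⟨(8 * π ^ 2 + 16 * π ^ 4) * M, by positivity, ?_⟩
  intro s hs hs1
  have hq0 : 0 ≤ exp (-(4 * π ^ 2 / s)) := (exp_pos _).le
  have hq1 : exp (-(4 * π ^ 2 / s)) ≤ 1 / 2 := by
    have h := exp_small 0 hs
    have h1 : exp (-(4 * π ^ 2 / s)) ≤ exp (-1) := by
      apply exp_le_exp.2
      apply neg_le_neg
      rw [le_div_iff₀ hs]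
      nlinarith [pi_gt_three]
    have : exp (-1) < 1 / 2 := by
      rw [exp_neg, inv_lt_comm₀ (exp_pos _) (by norm_num)]
      have := exp_one_gt_d9; norm_num; linarith
    linarith
  obtain ⟨⟨a1, a2⟩, b1, b2⟩ := hk _ hq0 hq1
  have hsm := exp_small (K + 2) hs
  rw [kappa1_transform hs, kappa2_transform hs]
  set q := exp (-(4 * π ^ 2 / s))
  set k1 := kappa1 q
  set k2 := kappa2 q
  have hk1 : k1 ≤ M * s ^ K * s ^ 2 := by
    refine a2.trans ((mul_le_mul_of_nonneg_left hsm hC0).trans (le_of_eq ?_))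
    rw [hM]; ring
  have hk2 : k2 ≤ M * s ^ K * s ^ 2 := by
    refine b2.trans ((mul_le_mul_of_nonneg_left hsm hC0).trans (le_of_eq ?_))
    rw [hM]; ring
  have d1 : k1 / s ^ 2 ≤ M * s ^ K := by rw [div_le_iff₀ (by positivity)]; exact hk1
  have d2 : k2 / s ^ 2 ≤ M * s ^ K := by rw [div_le_iff₀ (by positivity)]; exact hk2
  have d3 : k1 / s ≤ M * s ^ K := by
    refine le_trans ?_ d1
    apply div_le_div_of_nonneg_left a1 (by positivity)
    nlinarith
  have n1 : 0 ≤ k1 / s ^ 2 := by positivity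
  have n2 : 0 ≤ k2 / s ^ 2 := by positivity
  have n3 : 0 ≤ k1 / s := by positivity
  have hP := sq_nonneg π
  have hP4 : 0 ≤ π ^ 4 := by positivity
  constructor
  · have : π ^ 2 / 6 / s ^ 2 + 1 / 24 - 1 / (2 * s) - 4 * π ^ 2 / s ^ 2 * k1 - (π ^ 2 / 6 / s ^ 2 + 1 / 24 - 1 / (2 * s))
      = - (4 * π ^ 2 * (k1 / s ^ 2)) := by ring
    rw [this, abs_neg, abs_of_nonneg (by positivity)]
    have := mul_le_mul_of_nonneg_left d1 (by positivity : 0 ≤ 4 * π ^ 2)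
    have h5 : 0 ≤ M * s ^ K := by positivity
    nlinarith [mul_nonneg hP h5, mul_nonneg hP4 h5]
  · have : (π ^ 2 / 3 / s ^ 3 - 1 / (2 * s ^ 2) - 8 * π ^ 2 / s ^ 3 * k1 + 16 * π ^ 4 / s ^ 4 * k2) * s ^ 2 - (π ^ 2 / 3 / s - 1 / 2)
      = 16 * π ^ 4 * (k2 / s ^ 2) - 8 * π ^ 2 * (k1 / s) := by field_simp; ring
    rw [this]
    have e1 := mul_le_mul_of_nonneg_left d2 (by positivity : 0 ≤ 16 * π ^ 4)
    have e2 := mul_le_mul_of_nonneg_left d3 (by positivity : 0 ≤ 8 * π ^ 2)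
    have h5 : 0 ≤ M * s ^ K := by positivity
    rw [abs_le]
    constructor <;> nlinarith [mul_nonneg hP h5, mul_nonneg hP4 h5, mul_nonneg hP n3, mul_nonneg hP4 n2]

/-- monotonicity of kappa1 -/
lemma kappa1_mono {p q : ℝ} (hp : 0 ≤ p) (hpq : p ≤ q) (hq : q < 1) : kappa1 p ≤ kappa1 q := by
  unfold kappa1
  apply Summable.tsum_le_tsum _ (summable_k1 hp (hpq.trans_lt hq)) (summable_k1 (hp.trans hpq) hq)
  intro j
  have h1 : p ^ (j + 1) ≤ q ^ (j + 1) := pow_le_pow_left₀ hp hpq _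
  have h2 : q ^ (j + 1) < 1 := pow_lt_one₀ (hp.trans hpq) hq (by omega)
  have h3 : 0 ≤ p ^ (j + 1) := pow_nonneg hp _
  have h4 : (0:ℝ) ≤ (j:ℝ) + 1 := by positivity
  apply div_le_div₀ (mul_nonneg h4 (h3.trans h1)) (mul_le_mul_of_nonneg_left h1 h4) (by linarith) (by linarith)

end PX

namespace PX
open scoped Topology
open Asymptotics

noncomputable def uz (n : ℕ) : ℝ := (1 + 2 * rseq n) / (2 * π ^ 2 / 3)

lemma rseq_sq {n : ℕ} (hn : 1 ≤ n) : rseq n ^ 2 = 2 * π ^ 2 / 3 * ((n : ℝ) - 1 / 24) + 1 / 4 := by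
  unfold rseq
  apply Real.sq_sqrt
  have : (1 : ℝ) ≤ n := by exact_mod_cast hn
  have : 0 ≤ (n : ℝ) - 1 / 24 := by linarith
  positivity

lemma rseq_nonneg (n : ℕ) : 0 ≤ rseq n := Real.sqrt_nonneg _

lemma rseq_tendsto : Tendsto rseq atTop atTop := by
  unfold rseq
  apply Real.tendsto_sqrt_atTop.comp
  apply tendsto_atTop_add_const_right
  apply Tendsto.const_mul_atTop (by positivity)
  apply tendsto_atTop_add_const_right atTop (-(1/24) : ℝ) tendsto_natCast_atTop_atTop

lemma uz_pos (n : ℕ) : 0 < uz n := by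
  unfold uz
  have := rseq_nonneg n
  positivity

lemma uz_tendsto : Tendsto uz atTop atTop := by
  unfold uz
  apply Tendsto.atTop_div_const (by positivity)
  apply tendsto_atTop_add_const_left
  exact Tendsto.const_mul_atTop (by norm_num) rseq_tendsto

lemma key_est (K : ℕ) : ∃ C, 0 ≤ C ∧ ∀ (n : ℕ) (s : ℝ), 1 ≤ n → 0 < s → s ≤ 1 → kappa1 (exp (-s)) = n →
    |1 / s - uz n| ≤ C * s ^ K ∧ |kappa2 (exp (-s)) * s ^ 2 - rseq n| ≤ C * s ^ K := by
  obtain ⟨C, hC, h⟩ := kap_asymp K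
  refine ⟨(2 + 2 * π ^ 2) * C, by positivity, ?_⟩
  intro n s hn hs hs1 hk
  obtain ⟨h1, h2⟩ := h s hs hs1
  rw [hk] at h1
  have hr := rseq_sq hn
  have hr0 := rseq_nonneg n
  have hu0 := uz_pos n
  have hpi := Real.pi_gt_three
  have hus : 1 ≤ 1 / s := by rw [le_div_iff₀ hs]; linarith
  have eu : π ^ 2 / 6 * uz n ^ 2 - uz n / 2 = n - 1 / 24 := by
    have : (n : ℝ) - 1 / 24 = (rseq n ^ 2 - 1 / 4) / (2 * π ^ 2 / 3) := by rw [hr]; field_simp; ring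
    rw [this]; unfold uz; field_simp; ring
  have er : rseq n = π ^ 2 / 3 * uz n - 1 / 2 := by unfold uz; field_simp; ring
  have e1 : (n : ℝ) - (π ^ 2 / 6 / s ^ 2 + 1 / 24 - 1 / (2 * s)) =
     - ((1 / s - uz n) * (π ^ 2 / 6 * (1 / s + uz n) - 1 / 2)) := by
    have : (n : ℝ) = π ^ 2 / 6 * uz n ^ 2 - uz n / 2 + 1 / 24 := by linarith
    rw [this]; field_simp; ring
  rw [e1, abs_neg, abs_mul] at h1
  have hb : 1 / 2 ≤ |π ^ 2 / 6 * (1 / s + uz n) - 1 / 2| := by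
    refine le_trans ?_ (le_abs_self _)
    nlinarith
  have h0 := abs_nonneg (1 / s - uz n)
  have hd : |1 / s - uz n| ≤ 2 * (C * s ^ K) := by nlinarith
  have hCs : 0 ≤ C * s ^ K := by positivity
  have hpC : 0 ≤ π ^ 2 * (C * s ^ K) := by positivity
  constructor
  · nlinarith
  · have : kappa2 (exp (-s)) * s ^ 2 - rseq n = (kappa2 (exp (-s)) * s ^ 2 - (π ^ 2 / 3 / s - 1 / 2)) + π ^ 2 / 3 * (1 / s - uz n) := by
      rw [er]; ring
    rw [this]
    refine (abs_add_le _ _).trans ?_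
    rw [abs_mul, abs_of_nonneg (by positivity : 0 ≤ π ^ 2 / 3)]
    nlinarith [mul_le_mul_of_nonneg_left hd (by positivity : 0 ≤ π ^ 2 / 3)]

section seq
variable {t : ℕ → ℝ} (ht : ∀ n : ℕ, 1 ≤ n → t n ∈ Set.Ioo (0 : ℝ) 1 ∧ kappa1 (t n) = n)
include ht

lemma s_pos {n : ℕ} (hn : 1 ≤ n) : 0 < -log (t n) := by
  have := (ht n hn).1
  have := Real.log_neg this.1 this.2
  linarith

lemma s_exp {n : ℕ} (hn : 1 ≤ n) : exp (-(-log (t n))) = t n := by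
  rw [neg_neg, Real.exp_log (ht n hn).1.1]

lemma s_le_one : ∀ᶠ n in atTop, -log (t n) ≤ 1 := by
  obtain ⟨m, hm⟩ := exists_nat_gt (kappa1 (exp (-1)))
  filter_upwards [eventually_ge_atTop (m + 1)] with n hn
  by_contra hlt
  push Not at hlt
  have hn1 : 1 ≤ n := by omega
  have h := ht n hn1
  have h1 : t n ≤ exp (-1) := by
    rw [← s_exp ht hn1]; exact exp_le_exp.2 (by linarith)
  have := kappa1_mono h.1.1.le h1 (by rw [Real.exp_lt_one_iff]; norm_num)
  rw [h.2] at this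
  have h3 : (m : ℝ) ≤ n := by exact_mod_cast (by omega : m ≤ n)
  linarith

lemma s_O : (fun n => -log (t n)) =O[atTop] fun n => (rseq n)⁻¹ := by
  obtain ⟨C, hC, h⟩ := key_est 0
  apply IsBigO.of_bound (2 * π ^ 2 / 3)
  filter_upwards [s_le_one ht, eventually_ge_atTop 1, uz_tendsto.eventually_ge_atTop (2 * C),
    rseq_tendsto.eventually_ge_atTop 1] with n h1 hn hu hr
  have hs := s_pos ht hn
  have h2 := (h n _ hn hs h1 (by rw [s_exp ht hn]; exact (ht n hn).2)).1
  set s := -log (t n)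
  rw [pow_zero, mul_one] at h2
  have h3 := (abs_le.1 h2).1
  have h4 : uz n / 2 ≤ 1 / s := by linarith
  have hr0 : 0 < rseq n := by linarith
  rw [Real.norm_of_nonneg hs.le, Real.norm_of_nonneg (by positivity)]
  have h5 : rseq n / (2 * π ^ 2 / 3) ≤ 1 / s := by
    refine le_trans ?_ h4
    unfold uz
    rw [div_div, div_le_div_iff₀ (by positivity) (by positivity)]
    have : 0 < 2 * π ^ 2 / 3 := by positivity
    nlinarith
  rw [div_le_div_iff₀ (by positivity) hs] at h5
  rw [← div_eq_mul_inv, le_div_iff₀ hr0]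
  linarith

lemma s_pow_O (K : ℕ) {f : ℕ → ℝ} {C : ℝ} (hf : ∀ᶠ n in atTop, |f n| ≤ C * (-log (t n)) ^ K) :
    f =O[atTop] fun n => (rseq n)⁻¹ ^ K := by
  refine IsBigO.trans ?_ ((s_O ht).pow K)
  apply IsBigO.of_bound C
  filter_upwards [hf, eventually_ge_atTop 1] with n h hn
  have hs := s_pos ht hn
  rw [Real.norm_eq_abs, Real.norm_of_nonneg (by positivity)]
  exact h

lemma u_O (K : ℕ) : (fun n => 1 / (-log (t n)) - uz n) =O[atTop] fun n => (rseq n)⁻¹ ^ K := by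
  obtain ⟨C, hC, h⟩ := key_est K
  apply s_pow_O ht K (C := C)
  filter_upwards [s_le_one ht, eventually_ge_atTop 1] with n h1 hn
  exact (h n _ hn (s_pos ht hn) h1 (by rw [s_exp ht hn]; exact (ht n hn).2)).1

lemma csq_O (K : ℕ) : (fun n => csq (t n) - rseq n) =O[atTop] fun n => (rseq n)⁻¹ ^ K := by
  obtain ⟨C, hC, h⟩ := key_est K
  apply s_pow_O ht K (C := C)
  filter_upwards [s_le_one ht, eventually_ge_atTop 1] with n h1 hn
  have := (h n _ hn (s_pos ht hn) h1 (by rw [s_exp ht hn]; exact (ht n hn).2)).2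
  rw [s_exp ht hn, neg_sq] at this
  exact this

end seq

end PX

namespace PX
open scoped Topology
open Asymptotics

noncomputable def SS (x : ℝ) : ℝ := √(1 - 4 * x)
noncomputable def CC (x : ℝ) : ℝ := 2 / (1 + SS x)
noncomputable def g (r : ℕ) (x : ℝ) : ℝ := CC x ^ r / SS x
noncomputable def GG (r : ℕ) (x : ℝ) : ℝ := CC x ^ r * (r * SS x + 1 + SS x ^ 2) / SS x ^ 3
/-- coefficients -/
noncomputable def b (k r : ℕ) : ℝ := (Nat.choose (2 * k + r) k : ℝ)
noncomputable def bb (k r : ℕ) : ℝ := (2 * k + r + 2 : ℝ) * b k r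

lemma SS_pos {x : ℝ} (hx : x < 1 / 4) : 0 < SS x := Real.sqrt_pos.2 (by linarith)
lemma SS_sq {x : ℝ} (hx : x < 1 / 4) : SS x ^ 2 = 1 - 4 * x := Real.sq_sqrt (by linarith)
lemma SS_zero : SS 0 = 1 := by simp [SS]
lemma SS_cont : ContinuousAt SS 0 := by unfold SS; fun_prop
lemma CC_cont : ContinuousAt CC 0 := by
  unfold CC
  apply ContinuousAt.div continuousAt_const (continuousAt_const.add SS_cont)
  show (1:ℝ) + SS 0 ≠ 0
  rw [SS_zero]; norm_num
lemma g_cont (r : ℕ) : ContinuousAt (g r) 0 := by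
  unfold g
  exact ContinuousAt.div (CC_cont.pow r) SS_cont (by rw [SS_zero]; norm_num)
lemma GG_cont (r : ℕ) : ContinuousAt (GG r) 0 := by
  unfold GG
  apply ContinuousAt.div
  · exact (CC_cont.pow r).mul (((continuousAt_const.mul SS_cont).add continuousAt_const).add (SS_cont.pow 2))
  · exact SS_cont.pow 3
  · rw [SS_zero]; norm_num

lemma CC_eq {x : ℝ} (hx : x < 1 / 4) : CC x = 1 + x * CC x ^ 2 := by
  have h1 := SS_pos hx
  have h2 := SS_sq hx
  have hx' : x = (1 - SS x ^ 2) / 4 := by linarith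
  unfold CC
  set S := SS x
  rw [hx']
  field_simp
  ring

lemma SS_eq {x : ℝ} (hx : x < 1 / 4) : SS x = 1 - 2 * x * CC x := by
  have h1 := SS_pos hx
  have h2 := SS_sq hx
  have hx' : x = (1 - SS x ^ 2) / 4 := by linarith
  unfold CC
  set S := SS x
  rw [hx']
  field_simp
  ring

lemma g_succ {x : ℝ} (hx : x < 1 / 4) (r : ℕ) : g (r + 1) x = g r x + x * g (r + 2) x := by
  have h1 := SS_pos hx
  unfold g
  have h := CC_eq hx
  have e : CC x ^ (r + 1) = CC x ^ r + x * CC x ^ (r + 2) := by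
    calc CC x ^ (r + 1) = CC x ^ r * CC x := pow_succ _ _
      _ = CC x ^ r * (1 + x * CC x ^ 2) := by rw [← h]
      _ = _ := by ring
  rw [e]; field_simp

lemma g_zero {x : ℝ} (hx : x < 1 / 4) : g 0 x = 1 + 2 * x * g 1 x := by
  have h1 := SS_pos hx
  have h := SS_eq hx
  unfold g
  field_simp
  linarith

lemma GG_succ {x : ℝ} (hx : x < 1 / 4) (r : ℕ) :
    GG (r + 1) x = GG r x + x * GG (r + 2) x + g (r + 1) x := by
  have h1 := SS_pos hx
  have h2 := SS_sq hx
  have hx' : x = (1 - SS x ^ 2) / 4 := by linarith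
  unfold GG g
  have e1 : CC x ^ (r + 1) = CC x ^ r * (2 / (1 + SS x)) := by rw [pow_succ, CC]
  have e2 : CC x ^ (r + 2) = CC x ^ r * (2 / (1 + SS x)) ^ 2 := by rw [pow_add, CC]
  rw [e1, e2]
  set S := SS x
  set P := CC x ^ r
  have : x * (P * (2 / (1 + S)) ^ 2 * (((r + 2 : ℕ) : ℝ) * S + 1 + S ^ 2) / S ^ 3) =
     ((1 - S ^ 2) / 4) * (P * (2 / (1 + S)) ^ 2 * (((r + 2 : ℕ) : ℝ) * S + 1 + S ^ 2) / S ^ 3) := by rw [← hx']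
  rw [this]
  push_cast
  field_simp
  ring

lemma GG_zero {x : ℝ} (hx : x < 1 / 4) : GG 0 x = 1 + 2 * x * GG 1 x + g 0 x := by
  have h1 := SS_pos hx
  have h2 := SS_sq hx
  have hx' : x = (1 - SS x ^ 2) / 4 := by linarith
  unfold GG g
  simp only [pow_zero, pow_one, CC]
  set S := SS x
  have : 2 * x * (2 / (1 + S) * (((1 : ℕ) : ℝ) * S + 1 + S ^ 2) / S ^ 3) =
    2 * ((1 - S ^ 2) / 4) * (2 / (1 + S) * (((1 : ℕ) : ℝ) * S + 1 + S ^ 2) / S ^ 3) := by rw [← hx']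
  rw [this]
  push_cast
  field_simp
  ring

lemma b_zero (r : ℕ) : b 0 r = 1 := by simp [b]
lemma b_succ (k r : ℕ) : b (k + 1) (r + 1) = b (k + 1) r + b k (r + 2) := by
  unfold b
  rw [show 2 * (k + 1) + (r + 1) = (2 * k + (r + 2)) + 1 by ring, Nat.choose_succ_succ,
    show 2 * (k + 1) + r = 2 * k + (r + 2) by ring]
  push_cast; ring
lemma b_succ_zero (k : ℕ) : b (k + 1) 0 = 2 * b k 1 := by
  unfold b
  rw [show 2 * (k + 1) + 0 = (2 * k + 1) + 1 by ring, Nat.choose_succ_succ]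
  have : Nat.choose (2 * k + 1) (k.succ) = Nat.choose (2 * k + 1) k := Nat.choose_symm_half k
  rw [this]
  push_cast; ring
lemma bb_succ (k r : ℕ) : bb (k + 1) (r + 1) = bb (k + 1) r + bb k (r + 2) + b (k + 1) (r + 1) := by
  unfold bb
  rw [b_succ]; push_cast; ring
lemma bb_succ_zero (k : ℕ) : bb (k + 1) 0 = 2 * bb k 1 + b (k + 1) 0 := by
  unfold bb
  rw [b_succ_zero]; push_cast; ring

lemma ev_lt : ∀ᶠ x : ℝ in 𝓝 0, x < 1 / 4 := gt_mem_nhds (by norm_num)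

lemma id_mul_O {f : ℝ → ℝ} {n : ℕ} (h : f =O[𝓝 0] fun x : ℝ => x ^ n) (c : ℝ) :
    (fun x => c * x * f x) =O[𝓝 0] fun x : ℝ => x ^ (n + 1) := by
  have h1 : (fun x : ℝ => c * x) =O[𝓝 0] fun x : ℝ => x := (isBigO_refl _ _).const_mul_left c
  have := h1.mul h
  refine this.congr_right ?_
  intro x; ring

lemma g_exp (n : ℕ) : ∀ r : ℕ, (fun x => g r x - ∑ k ∈ Finset.range n, b k r * x ^ k) =O[𝓝 0] fun x : ℝ => x ^ n := by
  induction n with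
  | zero =>
    intro r
    simp only [Finset.range_zero, Finset.sum_empty, sub_zero, pow_zero]
    exact (g_cont r).tendsto.isBigO_one ℝ
  | succ n ih =>
    intro r
    induction r with
    | zero =>
      refine (id_mul_O (ih 1) 2).congr' ?_ EventuallyEq.rfl
      filter_upwards [ev_lt] with x hx
      rw [Finset.sum_range_succ', g_zero hx, b_zero]
      simp_rw [b_succ_zero]
      rw [mul_sub, Finset.mul_sum]
      have : ∀ k, 2 * x * (b k 1 * x ^ k) = 2 * b k 1 * x ^ (k + 1) := by intro k; ring
      simp_rw [this]
      ring
    | succ r ihr =>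
      refine (ihr.add (id_mul_O (ih (r + 2)) 1)).congr' ?_ EventuallyEq.rfl
      filter_upwards [ev_lt] with x hx
      rw [Finset.sum_range_succ', Finset.sum_range_succ', g_succ hx r, b_zero, b_zero]
      simp_rw [b_succ]
      rw [mul_sub, Finset.mul_sum]
      have : ∀ k, 1 * x * (b k (r + 2) * x ^ k) = b k (r + 2) * x ^ (k + 1) := by intro k; ring
      simp_rw [this, add_mul, Finset.sum_add_distrib]
      ring

lemma GG_exp (n : ℕ) : ∀ r : ℕ, (fun x => GG r x - ∑ k ∈ Finset.range n, bb k r * x ^ k) =O[𝓝 0] fun x : ℝ => x ^ n := by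
  induction n with
  | zero =>
    intro r
    simp only [Finset.range_zero, Finset.sum_empty, sub_zero, pow_zero]
    exact (GG_cont r).tendsto.isBigO_one ℝ
  | succ n ih =>
    intro r
    induction r with
    | zero =>
      refine ((id_mul_O (ih 1) 2).add (g_exp (n + 1) 0)).congr' ?_ EventuallyEq.rfl
      filter_upwards [ev_lt] with x hx
      rw [Finset.sum_range_succ', Finset.sum_range_succ', GG_zero hx, b_zero]
      simp_rw [bb_succ_zero]
      rw [mul_sub, Finset.mul_sum]
      have : ∀ k, 2 * x * (bb k 1 * x ^ k) = 2 * bb k 1 * x ^ (k + 1) := by intro k; ring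
      simp_rw [this, add_mul, Finset.sum_add_distrib]
      simp [bb, b_zero]
      ring
    | succ r ihr =>
      refine ((ihr.add (id_mul_O (ih (r + 2)) 1)).add (g_exp (n + 1) (r + 1))).congr' ?_ EventuallyEq.rfl
      filter_upwards [ev_lt] with x hx
      rw [Finset.sum_range_succ', Finset.sum_range_succ', Finset.sum_range_succ', GG_succ hx r]
      simp_rw [bb_succ]
      rw [mul_sub, Finset.mul_sum]
      have : ∀ k, 1 * x * (bb k (r + 2) * x ^ k) = bb k (r + 2) * x ^ (k + 1) := by intro k; ring
      simp_rw [this, add_mul, Finset.sum_add_distrib]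
      simp [bb, b_zero]
      ring

end PX

namespace PX
open scoped Topology
open Asymptotics

noncomputable def uu (x : ℝ) : ℝ := -(1 - SS x) / (2 * (1 + SS x))
noncomputable def TT (j : ℕ) (x : ℝ) : ℝ :=
  (j : ℝ) * uu x ^ (j - 1) / SS x ^ 2 + uu x ^ j * ((SS x ^ 2 - 1) / SS x ^ 3)
noncomputable def cf (l j : ℕ) : ℝ :=
  if j ≤ l + 1 then ((l : ℝ) + 1) * (Nat.choose (2 * l) (l + 1 - j) : ℝ) * (-1 / 2) ^ j * (-2) else 0

lemma uu_eq {x : ℝ} (hx : x < 1 / 4) : uu x = (-x / 2) * CC x ^ 2 := by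
  have h1 := SS_pos hx
  have h2 := SS_sq hx
  have hx' : x = (1 - SS x ^ 2) / 4 := by linarith
  unfold uu CC
  set S := SS x
  rw [hx']
  field_simp
  ring

lemma TT_zero {x : ℝ} (hx : x < 1 / 4) : TT 0 x = -1 * x * GG 2 x := by
  have h1 := SS_pos hx
  have h2 := SS_sq hx
  have hx' : x = (1 - SS x ^ 2) / 4 := by linarith
  unfold TT GG CC
  set S := SS x
  rw [hx']
  simp
  field_simp
  ring

lemma TT_succ {x : ℝ} (hx : x < 1 / 4) (i : ℕ) :
    TT (i + 1) x = (1 / 2 * (-1 / 2) ^ i * x ^ i) * GG (2 * i) x := by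
  have h1 := SS_pos hx
  have h2 := SS_sq hx
  have hx' : x = (1 - SS x ^ 2) / 4 := by linarith
  have hu : uu x ^ i = (-1 / 2) ^ i * x ^ i * CC x ^ (2 * i) := by
    rw [uu_eq hx, mul_pow, ← pow_mul, ← mul_pow]; congr 2; ring
  have hu2 : uu x * (SS x ^ 2 - 1) = (1 - SS x) ^ 2 / 2 := by
    unfold uu; field_simp; ring
  unfold TT GG
  rw [Nat.add_sub_cancel, pow_succ (uu x) i, hu]
  have : (-1 / 2) ^ i * x ^ i * CC x ^ (2 * i) * uu x * ((SS x ^ 2 - 1) / SS x ^ 3) =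
    (-1 / 2) ^ i * x ^ i * CC x ^ (2 * i) * (uu x * (SS x ^ 2 - 1)) / SS x ^ 3 := by ring
  rw [this, hu2]
  push_cast
  field_simp
  ring

lemma TT_exp (N j : ℕ) (hj : j ≤ N + 1) :
    (fun x => TT j x - ∑ l ∈ Finset.range (N + 1), cf l j * x ^ l) =O[𝓝 0] fun x : ℝ => x ^ (N + 1) := by
  rcases j with _ | i
  · refine (id_mul_O (GG_exp N 2) (-1)).congr' ?_ EventuallyEq.rfl
    filter_upwards [ev_lt] with x hx
    rw [TT_zero hx, Finset.sum_range_succ']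
    have h0 : cf 0 0 = 0 := by simp [cf]
    have hk : ∀ k, cf (k + 1) 0 = - bb k 2 := by
      intro k
      have e : Nat.choose (2 * (k + 1)) (k + 1 + 1) = Nat.choose (2 * k + 2) k := by
        rw [show 2 * (k + 1) = 2 * k + 2 by ring]
        exact (Nat.choose_symm_of_eq_add (by ring))
      simp only [cf, bb, b, Nat.zero_le, if_true, Nat.sub_zero, e]
      push_cast; ring
    rw [h0]
    simp_rw [hk]
    rw [mul_sub, Finset.mul_sum]
    have : ∀ k, -1 * x * (bb k 2 * x ^ k) = - bb k 2 * x ^ (k + 1) := by intro k; ring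
    simp_rw [this]
    ring
  · obtain ⟨m, hm⟩ : ∃ m, N + 1 = i + m := ⟨N + 1 - i, by omega⟩
    have hG := (((isBigO_refl (fun x : ℝ => x ^ i) (𝓝 0)).const_mul_left (1 / 2 * (-1 / 2) ^ i))).mul (GG_exp m (2 * i))
    rw [hm]
    refine hG.congr' ?_ ?_
    · filter_upwards [ev_lt] with x hx
      rw [TT_succ hx, Finset.sum_range_add, mul_sub]
      have h0 : ∑ l ∈ Finset.range i, cf l (i + 1) * x ^ l = 0 := by
        apply Finset.sum_eq_zero
        intro l hl
        have := Finset.mem_range.1 hl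
        rw [cf, if_neg (by omega)]; ring
      have hk : ∀ k, cf (i + k) (i + 1) * x ^ (i + k) = (1 / 2 * (-1 / 2) ^ i * x ^ i) * (bb k (2 * i) * x ^ k) := by
        intro k
        rw [cf, if_pos (by omega), bb, b, show i + k + 1 - (i + 1) = k by omega,
          show 2 * (i + k) = 2 * k + 2 * i by ring]
        push_cast; ring
      rw [h0, Finset.mul_sum]
      simp_rw [hk]
      ring
    · exact Eventually.of_forall fun x => by simp only []; ring

noncomputable def Fx (x : ℝ) : ℝ := exp (uu x) * (1 / SS x ^ 2 + (SS x ^ 2 - 1) / SS x ^ 3)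

lemma uu_O : uu =O[𝓝 0] fun x : ℝ => x := by
  have h : (fun x : ℝ => CC x ^ 2) =O[𝓝 0] fun _ : ℝ => (1 : ℝ) := (CC_cont.pow 2).tendsto.isBigO_one ℝ
  have := ((isBigO_refl (fun x : ℝ => x) (𝓝 0)).const_mul_left (-1 / 2)).mul h
  refine this.congr' ?_ ?_
  · filter_upwards [ev_lt] with x hx
    rw [uu_eq hx]; ring
  · exact Eventually.of_forall fun x => by simp

lemma uu_tendsto : Tendsto uu (𝓝 0) (𝓝 0) := by
  exact uu_O.trans_tendsto tendsto_id

lemma exp_uu (n : ℕ) : (fun x => exp (uu x) - ∑ i ∈ Finset.range n, uu x ^ i / i.factorial) =O[𝓝 0]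
    fun x : ℝ => x ^ n := by
  have h := (Real.exp_sub_sum_range_isBigO_pow n).comp_tendsto uu_tendsto
  exact h.trans (uu_O.pow n)

lemma Fx_exp1 (N : ℕ) : (fun x => Fx x - ∑ j ∈ Finset.range (N + 2), TT j x / (j.factorial : ℝ)) =O[𝓝 0]
    fun x : ℝ => x ^ (N + 1) := by
  have c1 : (fun x : ℝ => 1 / SS x ^ 2) =O[𝓝 0] fun _ : ℝ => (1 : ℝ) := by
    have : ContinuousAt (fun x : ℝ => 1 / SS x ^ 2) 0 :=
      ContinuousAt.div continuousAt_const (SS_cont.pow 2) (by show SS 0 ^ 2 ≠ 0; rw [SS_zero]; norm_num)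
    exact this.tendsto.isBigO_one ℝ
  have c2 : (fun x : ℝ => (SS x ^ 2 - 1) / SS x ^ 3) =O[𝓝 0] fun _ : ℝ => (1 : ℝ) := by
    have : ContinuousAt (fun x : ℝ => (SS x ^ 2 - 1) / SS x ^ 3) 0 :=
      ContinuousAt.div ((SS_cont.pow 2).sub continuousAt_const) (SS_cont.pow 3) (by show SS 0 ^ 3 ≠ 0; rw [SS_zero]; norm_num)
    exact this.tendsto.isBigO_one ℝ
  have e1 := (exp_uu (N + 1)).mul c1
  have e2 := (exp_uu (N + 2)).mul c2
  have e3 : (fun x : ℝ => x ^ (N + 2) * 1) =O[𝓝 0] fun x : ℝ => x ^ (N + 1) * 1 := by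
    simp only [mul_one]
    exact (isLittleO_pow_pow (by omega)).isBigO
  have e4 := e1.add (e2.trans e3)
  refine e4.congr' ?_ ?_
  · filter_upwards with x
    have : ∑ j ∈ Finset.range (N + 2), TT j x / (j.factorial : ℝ) =
       (∑ j ∈ Finset.range (N + 1), uu x ^ j / j.factorial) * (1 / SS x ^ 2) +
       (∑ j ∈ Finset.range (N + 2), uu x ^ j / j.factorial) * ((SS x ^ 2 - 1) / SS x ^ 3) := by
      have h1 : ∑ j ∈ Finset.range (N + 2), TT j x / (j.factorial : ℝ) =
         ∑ j ∈ Finset.range (N + 2), ((j : ℝ) * uu x ^ (j - 1) / SS x ^ 2) / j.factorial +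
         ∑ j ∈ Finset.range (N + 2), uu x ^ j / j.factorial * ((SS x ^ 2 - 1) / SS x ^ 3) := by
        rw [← Finset.sum_add_distrib]
        apply Finset.sum_congr rfl
        intro j _
        unfold TT; ring
      rw [h1, Finset.sum_range_succ', Finset.sum_mul, Finset.sum_mul]
      congr 1
      simp only [Nat.cast_zero, zero_mul, zero_div, add_zero]
      apply Finset.sum_congr rfl
      intro j _
      rw [Nat.factorial_succ, Nat.add_sub_cancel]
      have : (j.factorial : ℝ) ≠ 0 := by positivity
      push_cast
      have h2 : (j : ℝ) + 1 ≠ 0 := by positivity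
      rw [mul_comm ((j:ℝ)+1) (j.factorial : ℝ), ← div_div]
      rw [mul_div_assoc, mul_comm ((j:ℝ)+1), div_div, mul_comm (j.factorial : ℝ), ← div_div, mul_div_assoc, div_self h2]
      ring
    rw [this]; unfold Fx; ring
  · exact Eventually.of_forall fun x => by simp

lemma cf_sum (N l : ℕ) (hl : l ≤ N) : ∑ j ∈ Finset.range (N + 2), cf l j / (j.factorial : ℝ) =
    ((l : ℝ) + 1) * (-1 / 2) ^ l * ∑ k ∈ Finset.range (l + 2),
      (-1 : ℝ) ^ k * 2 ^ k * (Nat.choose (2 * l) k : ℝ) / (Nat.factorial (l + 1 - k) : ℝ) := by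
  have hs : Finset.range (l + 2) ⊆ Finset.range (N + 2) := Finset.range_mono (by omega)
  rw [← Finset.sum_subset hs, ← Finset.sum_range_reflect, Finset.mul_sum]
  · apply Finset.sum_congr rfl
    intro k hk
    have hk := Finset.mem_range.1 hk
    rw [show l + 2 - 1 - k = l + 1 - k by omega, cf, if_pos (by omega), show l + 1 - (l + 1 - k) = k by omega]
    have : ((-1 : ℝ) / 2) ^ (l + 1 - k) * (-2) = (-1 / 2) ^ l * ((-1) ^ k * 2 ^ k) := by
      have e : ((-1 : ℝ) / 2) ^ (l + 1 - k) * (-1 / 2) ^ k = (-1 / 2) ^ (l + 1) := by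
        rw [← pow_add]; congr 1; omega
      have e2 : ((-1 : ℝ) / 2) ^ k * ((-1) ^ k * 2 ^ k) = 1 := by
        rw [← mul_pow, ← mul_pow]; norm_num
      calc ((-1 : ℝ) / 2) ^ (l + 1 - k) * (-2) = ((-1 : ℝ) / 2) ^ (l + 1 - k) * (-2) * (((-1 : ℝ) / 2) ^ k * ((-1) ^ k * 2 ^ k)) := by rw [e2, mul_one]
        _ = (((-1 : ℝ) / 2) ^ (l + 1 - k) * (-1 / 2) ^ k) * (-2) * ((-1) ^ k * 2 ^ k) := by ring
        _ = _ := by rw [e, pow_succ]; ring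
    have e3 : ∀ a c d f : ℝ, a * c * f * (-2) / d = a * (f * (-2)) * c / d := by intros; ring
    rw [e3, this]; ring
  · intro j _ hj
    rw [Finset.mem_range] at hj
    rw [cf, if_neg (by omega)]; simp

lemma Fx_exp (N : ℕ) : (fun x => Fx x - (1 - ∑ l ∈ Finset.Icc 1 N, Dcoef l * (2 * x) ^ l)) =O[𝓝 0]
    fun x : ℝ => x ^ (N + 1) := by
  have h1 : (fun x => ∑ j ∈ Finset.range (N + 2), (1 / (j.factorial : ℝ)) * (TT j x - ∑ l ∈ Finset.range (N + 1), cf l j * x ^ l))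
      =O[𝓝 0] fun x : ℝ => x ^ (N + 1) := by
    apply IsBigO.fun_sum
    intro j hj
    have := Finset.mem_range.1 hj
    exact (TT_exp N j (by omega)).const_mul_left _
  refine ((Fx_exp1 N).add h1).congr' ?_ EventuallyEq.rfl
  filter_upwards with x
  have h2 : ∑ j ∈ Finset.range (N + 2), (1 / (j.factorial : ℝ)) * (TT j x - ∑ l ∈ Finset.range (N + 1), cf l j * x ^ l) =
     ∑ j ∈ Finset.range (N + 2), TT j x / (j.factorial : ℝ) -
     ∑ l ∈ Finset.range (N + 1), (∑ j ∈ Finset.range (N + 2), cf l j / (j.factorial : ℝ)) * x ^ l := by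
    simp_rw [mul_sub, Finset.sum_sub_distrib, Finset.mul_sum, Finset.sum_mul]
    rw [Finset.sum_comm]
    congr 1
    · apply Finset.sum_congr rfl; intro j _; ring
    · apply Finset.sum_congr rfl; intro j _
      apply Finset.sum_congr rfl; intro l _; ring
  rw [h2]
  have h3 : ∑ l ∈ Finset.range (N + 1), (∑ j ∈ Finset.range (N + 2), cf l j / (j.factorial : ℝ)) * x ^ l =
     1 - ∑ l ∈ Finset.Icc 1 N, Dcoef l * (2 * x) ^ l := by
    rw [Finset.sum_range_succ', cf_sum N 0 (by omega)]
    have e0 : Finset.Icc 1 N = Finset.Ico 1 (N + 1) := by ext; simp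
    rw [e0, Finset.sum_Ico_eq_sum_range, sub_eq_neg_add, ← Finset.sum_neg_distrib, Nat.add_sub_cancel]
    congr 1
    · apply Finset.sum_congr rfl
      intro l hl
      have := Finset.mem_range.1 hl
      rw [cf_sum N (l + 1) (by omega), add_comm 1 l, Dcoef, mul_pow]
      have e4 : (4 : ℝ) ^ (l + 1) = 2 ^ (l + 1) * 2 ^ (l + 1) := by rw [← mul_pow]; norm_num
      have e5 : ((-1 : ℝ) / 2) ^ (l + 1) = (-1) ^ (l + 1) / 2 ^ (l + 1) := div_pow _ _ _
      rw [e4, e5, pow_succ (-1 : ℝ) (l + 1)]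
      have : (2 : ℝ) ^ (l + 1) ≠ 0 := by positivity
      field_simp
    · simp [Finset.sum_range_succ]
  rw [h3]; ring

end PX

namespace PX
open scoped Topology
open Asymptotics

noncomputable def rho (n : ℕ) : ℝ := √(2 * π ^ 2 / 3 * ((n : ℝ) - 1 / 24))
noncomputable def YY (n : ℕ) : ℝ := 1 + 2 * rseq n
noncomputable def Az (n : ℕ) : ℝ :=
  exp (rseq n) * (1 / uz n) ^ ((3 : ℝ) / 2) / (√2 * π * √(YY n))

lemma rho_sq {n : ℕ} (hn : 1 ≤ n) : rho n ^ 2 = rseq n ^ 2 - 1 / 4 := by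
  rw [rseq_sq hn]
  unfold rho
  have : (1 : ℝ) ≤ n := by exact_mod_cast hn
  have : 0 ≤ (n : ℝ) - 1 / 24 := by linarith
  rw [Real.sq_sqrt (by positivity)]; ring

lemma YY_pos (n : ℕ) : 0 < YY n := by have := rseq_nonneg n; unfold YY; linarith

lemma Az_pos (n : ℕ) : 0 < Az n := by
  have := YY_pos n
  have := uz_pos n
  unfold Az; positivity

lemma rpow_three_half {x : ℝ} (hx : 0 ≤ x) : x ^ ((3 : ℝ) / 2) = x * √x := by
  rw [show (3 : ℝ) / 2 = 1 + 1 / 2 by norm_num, Real.rpow_add' hx (by norm_num), Real.rpow_one, ← Real.sqrt_eq_rpow]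

lemma Az_eq (n : ℕ) : Az n = exp (rseq n) * (2 * π ^ 2 / 3) * √(π ^ 2 / 3) / (π * YY n ^ 2) := by
  have hY := YY_pos n
  have hu := uz_pos n
  have e : 1 / uz n = (2 * π ^ 2 / 3) / YY n := by unfold uz YY; rw [one_div_div]
  unfold Az
  rw [rpow_three_half (by positivity), e, Real.sqrt_div (by positivity)]
  have e2 : √(2 * π ^ 2 / 3) = √2 * √(π ^ 2 / 3) := by
    rw [← Real.sqrt_mul (by norm_num)]; congr 1; ring
  have e3 : YY n = √(YY n) ^ 2 := (Real.sq_sqrt hY.le).symm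
  have h2 : 0 < √(YY n) := Real.sqrt_pos.2 hY
  have h3 : 0 < √(2:ℝ) := Real.sqrt_pos.2 (by norm_num)
  rw [e2]
  generalize √(YY n) = y at *
  rw [e3]
  field_simp

lemma main_eq {n : ℕ} (hr : 1 ≤ rseq n) (hρ : 0 < rho n) (hn : 1 ≤ n) :
    (π ^ 2 / 3 / rho n) * √((π ^ 2 / 3 / rho n) / (2 * π)) *
      (exp (rho n) * (1 - 1 / rho n) * √(2 * π / rho n)) = 2 * π * (Az n * Fx (1 / (2 * YY n))) := by
  have hY := YY_pos n
  set ρ := rho n with hρd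
  set r := rseq n with hrd
  have hsq : ρ ^ 2 = r ^ 2 - 1 / 4 := rho_sq hn
  have hYr : YY n = 1 + 2 * r := rfl
  have hS : SS (1 / (2 * YY n)) = 2 * ρ / YY n := by
    unfold SS
    rw [Real.sqrt_eq_iff_eq_sq _ (by positivity)]
    · rw [div_pow, mul_pow, hsq, hYr]
      have : (1 + 2 * r) ≠ 0 := by linarith
      field_simp; ring
    · have : 4 * (1 / (2 * YY n)) = 2 / YY n := by field_simp; norm_num
      rw [this, sub_nonneg, div_le_one hY, hYr]; linarith
  have hu : uu (1 / (2 * YY n)) = ρ - r := by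
    unfold uu
    rw [hS, hYr]
    have h1 : (1 + 2 * r) ≠ 0 := by linarith
    have h2 : 1 + 2 * ρ / (1 + 2 * r) ≠ 0 := by positivity
    have h3 : 1 + 2 * r + 2 * ρ ≠ 0 := by positivity
    rw [div_eq_iff (by positivity)]
    field_simp
    nlinarith
  have hF : Fx (1 / (2 * YY n)) = exp (ρ - r) * ((1 - 1 / ρ) * (YY n ^ 2 / (4 * ρ ^ 2))) := by
    unfold Fx
    rw [hu, hS]
    congr 1
    have : YY n ^ 2 - 4 * ρ ^ 2 = 2 * YY n := by rw [hsq, hYr]; ring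
    have e : (2 * ρ / YY n) ^ 2 - 1 = - 2 / YY n := by
      rw [div_pow, mul_pow, hsq, hYr]
      have : (1 + 2 * r) ≠ 0 := by linarith
      field_simp; ring
    rw [e]
    field_simp; ring
  have hz : √((π ^ 2 / 3 / ρ) / (2 * π)) * √(2 * π / ρ) = √(π ^ 2 / 3) / ρ := by
    rw [← Real.sqrt_mul (by positivity)]
    have : π ^ 2 / 3 / ρ / (2 * π) * (2 * π / ρ) = π ^ 2 / 3 / ρ ^ 2 := by field_simp
    rw [this, Real.sqrt_div (by positivity), Real.sqrt_sq hρ.le]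
  have hL : π ^ 2 / 3 / ρ * √((π ^ 2 / 3 / ρ) / (2 * π)) * (exp ρ * (1 - 1 / ρ) * √(2 * π / ρ)) =
     π ^ 2 / 3 / ρ * exp ρ * (1 - 1 / ρ) * (√((π ^ 2 / 3 / ρ) / (2 * π)) * √(2 * π / ρ)) := by ring
  rw [hL, hz, hF, Az_eq, Real.exp_sub, ← hrd]
  generalize √(π ^ 2 / 3) = q
  have := exp_pos r
  generalize exp r = er at *
  generalize exp ρ = eρ
  generalize 1 - 1 / ρ = v
  field_simp
  ring

lemma rho_ge {n : ℕ} (hr : 1 ≤ rseq n) (hn : 1 ≤ n) : rseq n / 2 ≤ rho n := by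
  have h := rho_sq hn
  have h0 : 0 ≤ rho n := Real.sqrt_nonneg _
  nlinarith

lemma rho_le (n : ℕ) : rho n ≤ rseq n := by
  unfold rho rseq
  apply Real.sqrt_le_sqrt; linarith

lemma exp_O (K : ℕ) {δ : ℝ} (hδ : 0 < δ) :
    (fun n => YY n ^ 2 * exp (-δ * rseq n)) =O[atTop] fun n => (rseq n)⁻¹ ^ K := by
  have h1 : (fun n => YY n) =O[atTop] rseq := by
    apply IsBigO.of_bound 3
    filter_upwards [rseq_tendsto.eventually_ge_atTop 1] with n hr
    rw [Real.norm_of_nonneg (YY_pos n).le, Real.norm_of_nonneg (by linarith)]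
    unfold YY; linarith
  have h2 : (fun r : ℝ => exp (-δ * r)) =O[atTop] fun r : ℝ => r ^ (-((K + 2 : ℕ) : ℝ)) :=
    (isLittleO_exp_neg_mul_rpow_atTop hδ _).isBigO
  have h3 := (h1.pow 2).mul (h2.comp_tendsto rseq_tendsto)
  refine h3.congr' EventuallyEq.rfl ?_
  filter_upwards [rseq_tendsto.eventually_ge_atTop 1] with n hr
  simp only [Function.comp]
  rw [Real.rpow_neg (by linarith), Real.rpow_natCast, pow_add, inv_pow]
  field_simp

lemma p_O (K : ℕ) : (fun n => pp n / Az n - Fx (1 / (2 * YY n))) =O[atTop] fun n => (rseq n)⁻¹ ^ K := by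
  obtain ⟨C, hC, h⟩ := pp_asymp
  refine IsBigO.trans ?_ (exp_O K (δ := 0.07 * 3 / π ^ 2 / 2) (by positivity))
  set q := √(π ^ 2 / 3) with hq
  have hq0 : 0 < q := Real.sqrt_pos.2 (by positivity)
  apply IsBigO.of_bound (C / (2 * π) * (π / (2 * π ^ 2 / 3 * q)))
  filter_upwards [rseq_tendsto.eventually_ge_atTop (2 * π ^ 2), eventually_ge_atTop 1] with n hr' hn
  have hpi := Real.pi_gt_three
  have hr : 1 ≤ rseq n := by nlinarith
  have hρr := rho_ge hr hn
  have hρ : 0 < rho n := by linarith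
  have hle := rho_le n
  have hA := Az_pos n
  have e0 : π ^ 2 / 3 / (π ^ 2 / 3 / rho n) = rho n := by field_simp
  have h1 := h n (π ^ 2 / 3 / rho n) (by positivity) (by rw [div_le_one hρ]; nlinarith) (by
    have h2 := rho_sq hn
    rw [rseq_sq hn] at h2
    have : π ^ 2 / 6 / (π ^ 2 / 3 / rho n) ^ 2 = 3 / (2 * π ^ 2) * rho n ^ 2 := by field_simp; norm_num
    rw [this, h2]; field_simp; ring)
  rw [e0, main_eq hr hρ hn] at h1
  have hd : pp n / Az n - Fx (1 / (2 * YY n)) = (2 * π * pp n - 2 * π * (Az n * Fx (1 / (2 * YY n)))) / (2 * π * Az n) := by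
    field_simp
  rw [hd, norm_div, Real.norm_eq_abs, Real.norm_of_nonneg (by positivity), Real.norm_of_nonneg (by positivity),
    div_le_iff₀ (by positivity)]
  refine h1.trans ?_
  have e1 : exp (rho n - 0.07 / (π ^ 2 / 3 / rho n)) ≤ exp (rseq n) * exp (-(0.07 * 3 / π ^ 2 / 2) * rseq n) := by
    rw [← Real.exp_add]
    apply exp_le_exp.2
    have : 0.07 / (π ^ 2 / 3 / rho n) = (0.07 * 3 / π ^ 2) * rho n := by field_simp
    rw [this]
    have : (0.07 * 3 / π ^ 2) * (rseq n / 2) ≤ (0.07 * 3 / π ^ 2) * rho n := mul_le_mul_of_nonneg_left hρr (by positivity)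
    linarith
  refine (mul_le_mul_of_nonneg_left e1 hC).trans (le_of_eq ?_)
  rw [Az_eq, ← hq]
  have hY := YY_pos n
  generalize exp (rseq n) = a
  generalize exp (-(0.07 * 3 / π ^ 2 / 2) * rseq n) = b
  field_simp

lemma comp_O {f : ℝ → ℝ} {f' : ℝ} (hf : HasDerivAt f f' 1) {v : ℕ → ℝ} {K : ℕ} (hK : 0 < K)
    (hv : (fun n => v n - 1) =O[atTop] fun n => (rseq n)⁻¹ ^ K) :
    (fun n => f (v n) - f 1) =O[atTop] fun n => (rseq n)⁻¹ ^ K := by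
  have h0 : Tendsto (fun n => (rseq n)⁻¹ ^ K) atTop (𝓝 0) := by
    have := (tendsto_inv_atTop_zero.comp rseq_tendsto).pow K
    simpa [hK.ne'] using this
  have h1 : Tendsto v atTop (𝓝 1) := by
    have := (hv.trans_tendsto h0).add_const 1
    simpa using this
  exact (hf.isBigO_sub.comp_tendsto h1).trans hv

lemma inv_bdd {f : ℕ → ℝ} (hf : Tendsto f atTop atTop) : (fun n => (f n)⁻¹) =O[atTop] fun _ => (1 : ℝ) :=
  (tendsto_inv_atTop_zero.comp hf).isBigO_one ℝ

lemma YY_tendsto : Tendsto YY atTop atTop := by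
  unfold YY
  apply tendsto_atTop_add_const_left
  exact Tendsto.const_mul_atTop (by norm_num) rseq_tendsto

section seq
variable {t : ℕ → ℝ} (ht : ∀ n : ℕ, 1 ≤ n → t n ∈ Set.Ioo (0 : ℝ) 1 ∧ kappa1 (t n) = n)
include ht

lemma v1_O (K : ℕ) : (fun n => 1 / (-log (t n)) / uz n - 1) =O[atTop] fun n => (rseq n)⁻¹ ^ K := by
  refine ((u_O ht K).mul (inv_bdd uz_tendsto)).congr' ?_ ?_
  · filter_upwards with n
    have := uz_pos n
    field_simp
  · filter_upwards with n; simp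

lemma v2_O (K : ℕ) : (fun n => (1 + 2 * csq (t n)) / YY n - 1) =O[atTop] fun n => (rseq n)⁻¹ ^ K := by
  refine (((csq_O ht K).const_mul_left 2).mul (inv_bdd YY_tendsto)).congr' ?_ ?_
  · filter_upwards with n
    have := YY_pos n
    have e : YY n = 1 + 2 * rseq n := rfl
    field_simp; rw [e]; ring
  · filter_upwards with n; simp

lemma csq_pos_ev : ∀ᶠ n in atTop, 0 < 1 + 2 * csq (t n) := by
  have h0 : Tendsto (fun n => (rseq n)⁻¹ ^ 1) atTop (𝓝 0) := by
    simp only [pow_one]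
    exact tendsto_inv_atTop_zero.comp rseq_tendsto
  have h := (csq_O ht 1).trans_tendsto h0
  filter_upwards [h.eventually (lt_mem_nhds (show (-1 / 4 : ℝ) < 0 by norm_num))] with n hn
  have := rseq_nonneg n
  linarith

lemma A_ratio : ∀ᶠ n in atTop, exp (rseq n) * (-log (t n)) ^ ((3 : ℝ) / 2) / (√2 * π * √(1 + 2 * csq (t n))) *
    ((1 / (-log (t n)) / uz n) ^ ((3 : ℝ) / 2) * √((1 + 2 * csq (t n)) / YY n)) = Az n := by
  filter_upwards [csq_pos_ev ht, eventually_ge_atTop 1] with n hY hn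
  have hs := s_pos ht hn
  set s := -log (t n)
  set Y := 1 + 2 * csq (t n)
  have hu := uz_pos n
  have hYY := YY_pos n
  unfold Az
  have e : s ^ ((3 : ℝ) / 2) * (1 / s / uz n) ^ ((3 : ℝ) / 2) = (1 / uz n) ^ ((3 : ℝ) / 2) := by
    rw [← Real.mul_rpow hs.le (by positivity)]; congr 1; field_simp
  rw [← e, Real.sqrt_div hY.le]
  have h1 : 0 < √Y := Real.sqrt_pos.2 hY
  have h2 : 0 < √(YY n) := Real.sqrt_pos.2 hYY
  field_simp

lemma ratio_O (K : ℕ) (hK : 0 < K) : (fun n => (1 / (-log (t n)) / uz n) ^ ((3 : ℝ) / 2) * √((1 + 2 * csq (t n)) / YY n) - 1)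
    =O[atTop] fun n => (rseq n)⁻¹ ^ K := by
  have h1 := comp_O (f := fun x => x ^ ((3 : ℝ) / 2)) (Real.hasDerivAt_rpow_const (Or.inl one_ne_zero)) hK (v1_O ht K)
  have h2 := comp_O (f := fun x => √x) (Real.hasDerivAt_sqrt one_ne_zero) hK (v2_O ht K)
  simp only [Real.one_rpow, Real.sqrt_one] at h1 h2
  have h0 : (fun n => (rseq n)⁻¹ ^ K) =O[atTop] fun _ => (1 : ℝ) := by
    have := (inv_bdd rseq_tendsto).pow K
    simpa using this
  have h3 : (fun n => √((1 + 2 * csq (t n)) / YY n)) =O[atTop] fun _ => (1 : ℝ) := by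
    have := (h2.trans h0).add (isBigO_refl (fun _ : ℕ => (1 : ℝ)) atTop)
    simpa using this
  have h4 := h1.mul h3
  simp only [mul_one] at h4
  refine (h4.add h2).congr_left ?_
  intro n; ring

lemma Ypow_O (K : ℕ) (hK : 0 < K) (l : ℕ) : (fun n => 1 / (1 + 2 * csq (t n)) ^ l - (1 / YY n) ^ l)
    =O[atTop] fun n => (rseq n)⁻¹ ^ K := by
  have hd : HasDerivAt (fun x : ℝ => (x ^ l)⁻¹) _ 1 := (hasDerivAt_pow l (1 : ℝ)).fun_inv (by simp)
  have h2 := comp_O hd hK (v2_O ht K)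
  have h3 : (fun n => ((YY n)⁻¹) ^ l) =O[atTop] fun _ => (1 : ℝ) := by
    have := (inv_bdd YY_tendsto).pow l
    simpa using this
  have h4 := h2.mul h3
  simp only [mul_one] at h4
  refine h4.congr_left ?_
  intro n
  have := (YY_pos n).ne'
  have e : YY n ^ l * (YY n)⁻¹ ^ l = 1 := by rw [← mul_pow, mul_inv_cancel₀ this, one_pow]
  rw [div_pow, inv_div, one_pow, inv_one, one_div (YY n), sub_mul, div_mul_eq_mul_div, e, one_mul]

lemma R_O (N : ℕ) (R : ℕ → ℝ) (hR : ∀ n : ℕ, 1 ≤ n →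
      (Fintype.card (Nat.Partition n) : ℝ) =
        Real.exp (rseq n) * (-Real.log (t n)) ^ ((3 : ℝ) / 2) /
            (Real.sqrt 2 * Real.pi * Real.sqrt (1 + 2 * csq (t n))) *
          (1 - (∑ l ∈ Finset.Icc 1 N, Dcoef l / (1 + 2 * csq (t n)) ^ l) + R n)) :
    R =O[atTop] fun n => (rseq n)⁻¹ ^ (N + 1) := by
  have hK : 0 < N + 1 := by omega
  set w : ℕ → ℝ := fun n => 1 / (2 * YY n) with hw
  have hw0 : Tendsto w atTop (𝓝 0) := by
    have := tendsto_inv_atTop_zero.comp (Tendsto.const_mul_atTop (show (0:ℝ) < 2 by norm_num) YY_tendsto)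
    refine this.congr ?_
    intro n; simp [hw]
  have hwO : w =O[atTop] fun n => (rseq n)⁻¹ := by
    apply IsBigO.of_bound 1
    filter_upwards [rseq_tendsto.eventually_ge_atTop 1] with n hr
    have := YY_pos n
    rw [Real.norm_of_nonneg (by positivity), Real.norm_of_nonneg (by positivity), one_mul, hw, inv_eq_one_div]
    apply one_div_le_one_div_of_le (by linarith)
    unfold YY; linarith
  -- the four pieces
  have h1 := p_O (N + 1)
  have h2 : (fun n => Fx (w n) - (1 - ∑ l ∈ Finset.Icc 1 N, Dcoef l * (2 * w n) ^ l)) =O[atTop] fun n => (rseq n)⁻¹ ^ (N + 1) :=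
    ((Fx_exp N).comp_tendsto hw0).trans (hwO.pow (N + 1))
  have h3 : (fun n => ∑ l ∈ Finset.Icc 1 N, Dcoef l * (1 / (1 + 2 * csq (t n)) ^ l - (1 / YY n) ^ l)) =O[atTop]
      fun n => (rseq n)⁻¹ ^ (N + 1) := by
    apply IsBigO.fun_sum
    intro l _
    exact (Ypow_O ht (N + 1) hK l).const_mul_left _
  have hF : (fun n => Fx (w n)) =O[atTop] fun _ => (1 : ℝ) := by
    have hc : ContinuousAt Fx 0 := by
      unfold Fx uu
      have hS := SS_cont
      have h0 := SS_zero
      have e1 : SS 0 ^ 2 ≠ 0 := by rw [h0]; norm_num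
      have e2 : SS 0 ^ 3 ≠ 0 := by rw [h0]; norm_num
      have e3 : 2 * (1 + SS 0) ≠ 0 := by rw [h0]; norm_num
      fun_prop (disch := assumption)
    exact (hc.tendsto.comp hw0).isBigO_one ℝ
  have h0 : (fun n => (rseq n)⁻¹ ^ (N + 1)) =O[atTop] fun _ => (1 : ℝ) := by
    have := (inv_bdd rseq_tendsto).pow (N + 1)
    simpa using this
  have hp : (fun n => pp n / Az n) =O[atTop] fun _ => (1 : ℝ) := by
    refine ((h1.trans h0).add hF).congr_left ?_
    intro n; simp [hw]
  have h4 := hp.mul (ratio_O ht (N + 1) hK)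
  simp only [one_mul] at h4
  refine (((h4.add h1).add h2).add h3).congr' ?_ EventuallyEq.rfl
  filter_upwards [A_ratio ht, csq_pos_ev ht, eventually_ge_atTop 1] with n hA hY hn
  have hs := s_pos ht hn
  have hRn := hR n hn
  change pp n = _ at hRn
  have hAz := Az_pos n
  set s := -log (t n)
  set Y := 1 + 2 * csq (t n)
  set A := exp (rseq n) * s ^ ((3 : ℝ) / 2) / (√2 * π * √Y)
  set Q := (1 / s / uz n) ^ ((3 : ℝ) / 2) * √(Y / YY n)
  have hApos : 0 < A := by positivity
  have hpA : pp n / Az n * Q = 1 - (∑ l ∈ Finset.Icc 1 N, Dcoef l / Y ^ l) + R n := by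
    have hQ : Q ≠ 0 := by
      intro h; rw [h, mul_zero] at hA; linarith
    rw [← hA, hRn]; field_simp
  have e2 : 2 * w n = 1 / YY n := by
    have := YY_pos n
    simp only [hw]; field_simp
  have e3 : ∑ l ∈ Finset.Icc 1 N, Dcoef l * (1 / Y ^ l - (1 / YY n) ^ l) =
     ∑ l ∈ Finset.Icc 1 N, Dcoef l / Y ^ l - ∑ l ∈ Finset.Icc 1 N, Dcoef l * (1 / YY n) ^ l := by
    rw [← Finset.sum_sub_distrib]
    apply Finset.sum_congr rfl
    intro l _; ring
  have e4 : pp n / Az n * (Q - 1) = pp n / Az n * Q - pp n / Az n := by ring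
  rw [e2, e3, e4, hpA]
  simp only [hw]
  ring

end seq

lemma fin (N : ℕ) (R : ℕ → ℝ) (h : R =O[atTop] fun n => (rseq n)⁻¹ ^ (N + 1)) :
    Tendsto (fun n : ℕ => (n : ℝ) ^ ((N : ℝ) / 2) * R n) atTop (𝓝 0) := by
  have h1 : (fun n : ℕ => (n : ℝ) ^ ((N : ℝ) / 2)) =O[atTop] fun n => rseq n ^ N := by
    apply IsBigO.of_bound 1
    filter_upwards [eventually_ge_atTop 1] with n hn
    have hn' : (1 : ℝ) ≤ n := by exact_mod_cast hn
    have hr0 := rseq_nonneg n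
    rw [Real.norm_of_nonneg (by positivity), Real.norm_of_nonneg (by positivity), one_mul]
    have : (n : ℝ) ≤ rseq n ^ 2 := by
      rw [rseq_sq hn]
      have : (9:ℝ) ≤ π ^ 2 := by nlinarith [Real.pi_gt_three]
      nlinarith
    calc (n : ℝ) ^ ((N : ℝ) / 2) ≤ (rseq n ^ 2) ^ ((N : ℝ) / 2) := Real.rpow_le_rpow (by positivity) this (by positivity)
      _ = rseq n ^ N := by
        rw [← Real.rpow_natCast (rseq n) 2, ← Real.rpow_mul hr0, ← Real.rpow_natCast]
        congr 1; push_cast; ring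
  have h2 := h1.mul h
  refine h2.trans_tendsto ?_
  refine (tendsto_inv_atTop_zero.comp rseq_tendsto).congr' ?_
  filter_upwards [rseq_tendsto.eventually_ge_atTop 1] with n hr
  simp only [Function.comp]
  have : rseq n ≠ 0 := by linarith
  rw [inv_pow, pow_succ]; field_simp


end PX

/-- For every positive integer `N`, the error term `R̃` implicitly defined by the
expansion of `p(n)` in Theorem 1 satisfies `n^{N/2}·R̃(n) → 0` as `n → ∞`. -/
theorem stmt0 (N : ℕ) (hN : 0 < N) (t : ℕ → ℝ)
    (ht : ∀ n : ℕ, 1 ≤ n → t n ∈ Set.Ioo (0 : ℝ) 1 ∧ kappa1 (t n) = n)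
    (R : ℕ → ℝ)
    (hR : ∀ n : ℕ, 1 ≤ n →
      (Fintype.card (Nat.Partition n) : ℝ) =
        Real.exp (rseq n) * (-Real.log (t n)) ^ ((3 : ℝ) / 2) /
            (Real.sqrt 2 * Real.pi * Real.sqrt (1 + 2 * csq (t n))) *
          (1 - (∑ l ∈ Finset.Icc 1 N, Dcoef l / (1 + 2 * csq (t n)) ^ l) + R n)) :
    Tendsto (fun n : ℕ => (n : ℝ) ^ ((N : ℝ) / 2) * R n) atTop (nhds 0) := by
  exact PX.fin N R (PX.R_O ht N R hR)
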